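/- There exists a universal constant c > 0 such that the following is true. Let (n, k, ε, p) ∈ ℕ × ℕ × (0,1/2) × [1,∞) with n ≥ 2, and let (ω_i)_{i=1}^n be a non-increasing sequence in [0,1] with ω₁ = 1; let |x|_{ω,p} = (∑_{i=1}^{n} ω_i·x_[i]^p)^{1/p} be the corresponding Lorentz norm, and let G be an n×k random matrix with i.i.d. standard normal entries. If p ≠ 1, set d = (1 + 1/(p−1))^{-1}·min{ c^p·(∑_{i=1}^{n} ω_i·(ln(n/i))^{p/2})²·ε² / (∑_{i=1}^{n} ω_i²·(ln(n/i))^{p−1}), c·B^{-1/p}·(∑_{i=1}^{n} ω_i·(ln(n/i))^{p/2})^{2/p}·ε^{2/p} }, where B = ∑_{i=1}^{n} ω_i²·i^{-(p−1)} if 1 < p < 3/2, B = (∑_{i=1}^{n} ω_i^{2/(2−p)})^{2−p} if 3/2 ≤ p < 2, and B = 1 if 2 ≤ p < ∞; if p = 1, set d = c·(∑_{i=1}^{n} ω_i·(ln(n/i))^{1/2})²·ε² / ∑_{i=1}^{n} ω_i². Assume k ≤ d. Then with probability at least 1 − 2·e^{−d}, for all x ∈ ℝ^k: (1−ε)·|x|·𝕄|Ge₁|_{ω,p}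 ≤ |Gx|_{ω,p} ≤ (1+ε)·|x|·𝕄|Ge₁|_{ω,p}. -/

import Mathlib

open MeasureTheory ProbabilityTheory

/-- `decRe x` is the non-increasing rearrangement of `(|x_1|, …, |x_n|)`
(indexed from `0`, so `decRe x i = x_[i+1]` in the paper's notation). -/
noncomputable def decRe {n : ℕ} (x : Fin n → ℝ) : Fin n → ℝ :=
  fun i => |x (Tuple.sort (fun j => |x j|) i.rev)|

/-- The general Lorentz norm `|x|_{ω,p} = (∑_{i=1}^n ω_i x_[i]^p)^{1/p}`. -/
noncomputable def lorNormW {n : ℕ} (ω : Fin n → ℝ) (p : ℝ) (x : Fin n → ℝ) : ℝ :=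
  (∑ i : Fin n, ω i * decRe x i ^ p) ^ (1 / p)

/-- The standard Gaussian measure `N(0, I_n)` on `ℝ^n`. -/
noncomputable def stdGaussian (n : ℕ) : Measure (Fin n → ℝ) :=
  Measure.pi fun _ => gaussianReal 0 1

/-- The law of an `n × k` random matrix with i.i.d. standard normal entries. -/
noncomputable def gaussMatrix (n k : ℕ) : Measure (Fin n → Fin k → ℝ) :=
  Measure.pi fun _ => Measure.pi fun _ => gaussianReal 0 1

/-- `mulVec g x = Gx`, the matrix-vector product. -/
noncomputable def mulVec {n k : ℕ} (g : Fin n → Fin k → ℝ) (x : Fin k → ℝ) : Fin n → ℝ :=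
  fun i => ∑ j : Fin k, g i j * x j

/-- The Euclidean norm on `Fin k → ℝ`. -/
noncomputable def eucNorm {k : ℕ} (x : Fin k → ℝ) : ℝ :=
  Real.sqrt (∑ j : Fin k, x j ^ 2)

/-- `m` is a median of `f` under `μ`. -/
def IsMedian {α : Type*} [MeasurableSpace α] (μ : Measure α) (f : α → ℝ) (m : ℝ) : Prop :=
  (1 : ENNReal) / 2 ≤ μ {x | m ≤ f x} ∧ (1 : ENNReal) / 2 ≤ μ {x | f x ≤ m}

/-- The quantity `B` of Theorem `LoMain2`. -/
noncomputable def BGen {n : ℕ} (ω : Fin n → ℝ) (p : ℝ) : ℝ :=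
  if p < 3 / 2 then ∑ i : Fin n, ω i ^ 2 * ((i : ℝ) + 1) ^ (-(p - 1))
  else if p < 2 then (∑ i : Fin n, ω i ^ (2 / (2 - p))) ^ (2 - p)
  else 1

/-- The dimension `d` of Theorem `LoMain2`. -/
noncomputable def dGen {n : ℕ} (ω : Fin n → ℝ) (p ε c : ℝ) : ℝ :=
  if p = 1 then
    c * (∑ i : Fin n, ω i * Real.log ((n : ℝ) / ((i : ℝ) + 1)) ^ ((1 : ℝ) / 2)) ^ 2 * ε ^ 2 /
      ∑ i : Fin n, ω i ^ 2
  else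
    (1 + 1 / (p - 1))⁻¹ *
      min (c ^ p * (∑ i : Fin n, ω i * Real.log ((n : ℝ) / ((i : ℝ) + 1)) ^ (p / 2)) ^ 2 *
            ε ^ 2 / ∑ i : Fin n, ω i ^ 2 * Real.log ((n : ℝ) / ((i : ℝ) + 1)) ^ (p - 1))
        (c * BGen ω p ^ (-(1 / p)) *
          (∑ i : Fin n, ω i * Real.log ((n : ℝ) / ((i : ℝ) + 1)) ^ (p / 2)) ^ (2 / p) *
          ε ^ (2 / p))

theorem absolutelyContinuous_pi_const {μ ν : Measure ℝ} [SigmaFinite μ] [SigmaFinite ν]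
    (h : μ ≪ ν) (n : ℕ) :
    Measure.pi (fun _ : Fin n => μ) ≪ Measure.pi (fun _ : Fin n => ν) := by
  induction n with
  | zero => rw [Measure.pi_of_empty, Measure.pi_of_empty]
  | succ n ih =>
    have h1 := measurePreserving_piFinSuccAbove (fun _ : Fin (n + 1) => μ) 0
    have h2 := measurePreserving_piFinSuccAbove (fun _ : Fin (n + 1) => ν) 0
    have e1 := h1.symm.map_eq
    have e2 := h2.symm.map_eq
    rw [← e1, ← e2]
    exact (h.prod ih).map (MeasurableEquiv.measurable _)

theorem stdGaussian_euclidean_absolutelyContinuous (n : ℕ) :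
    ProbabilityTheory.stdGaussian (EuclideanSpace ℝ (Fin n)) ≪ volume := by
  rw [← map_pi_eq_stdGaussian, ← (PiLp.volume_preserving_toLp (Fin n)).map_eq]
  exact (absolutelyContinuous_pi_const
    (gaussianReal_absolutelyContinuous 0 one_ne_zero) n).map (by fun_prop)

section Rotation

variable {E : Type*} [NormedAddCommGroup E] [InnerProductSpace ℝ E] [FiniteDimensional ℝ E]
  [MeasurableSpace E] [BorelSpace E]

theorem measurePreserving_rotation_stdGaussian (θ : ℝ) :
    MeasurePreserving (ContinuousLinearMap.rotation (E := E) θ)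
      ((ProbabilityTheory.stdGaussian E).prod (ProbabilityTheory.stdGaussian E))
      ((ProbabilityTheory.stdGaussian E).prod (ProbabilityTheory.stdGaussian E)) :=
  ⟨(ContinuousLinearMap.rotation θ).continuous.measurable,
    IsGaussian.map_rotation_eq_self (by simp [integral_id_stdGaussian]) θ⟩

theorem lintegral_exp_dual_stdGaussian (ℓ : StrongDual ℝ E) :
    ∫⁻ x, ENNReal.ofReal (Real.exp (ℓ x)) ∂(ProbabilityTheory.stdGaussian E) =
      ENNReal.ofReal (Real.exp (‖ℓ‖ ^ 2 / 2)) := by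
  have hmap := IsGaussian.map_eq_gaussianReal (μ := ProbabilityTheory.stdGaussian E) ℓ
  rw [integral_strongDual_stdGaussian, variance_dual_stdGaussian] at hmap
  have hm := mgf_gaussianReal hmap 1
  have hInt : Integrable (fun x => Real.exp (ℓ x)) (ProbabilityTheory.stdGaussian E) := by
    have := integrable_exp_mul_gaussianReal (μ := 0) (v := (‖ℓ‖ ^ 2).toNNReal) 1
    rw [← hmap, integrable_map_measure (by fun_prop) (by fun_prop)] at this
    simpa [Function.comp_def] using this
  rw [← ofReal_integral_eq_lintegral_ofReal hInt (ae_of_all _ fun x => (Real.exp_pos _).le)]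
  rw [mgf] at hm
  simp only [one_mul] at hm
  rw [hm, Real.coe_toNNReal _ (by positivity)]
  simp

theorem lintegral_exp_mul_norm_stdGaussian_lt_top (K : ℝ) :
    ∫⁻ x, ENNReal.ofReal (Real.exp (K * ‖x‖)) ∂(ProbabilityTheory.stdGaussian E) < ⊤ := by
  obtain ⟨C, hC, hInt⟩ :=
    IsGaussian.exists_integrable_exp_sq (ProbabilityTheory.stdGaussian E)
  have h2 := (hInt.const_mul (Real.exp (K ^ 2 / (4 * C)))).lintegral_lt_top
  refine lt_of_le_of_lt (lintegral_mono fun x => ENNReal.ofReal_le_ofReal ?_) h2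
  rw [← Real.exp_add]
  apply Real.exp_le_exp.2
  have : K ^ 2 / (4 * C) + C * ‖x‖ ^ 2 - K * ‖x‖ = C * (‖x‖ - K / (2 * C)) ^ 2 := by
    field_simp
    ring
  have : 0 ≤ C * (‖x‖ - K / (2 * C)) ^ 2 := by positivity
  linarith

omit [FiniteDimensional ℝ E] [MeasurableSpace E] [BorelSpace E] in
theorem sub_rotation_eq_sum (f : E → ℝ) (δ : ℝ) (z : E × E) (m : ℕ) :
    f z.1 - f (ContinuousLinearMap.rotation (m * δ) z).1 =
      ∑ j ∈ Finset.range m,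
        (f (ContinuousLinearMap.rotation (j * δ) z).1 -
          f (ContinuousLinearMap.rotation δ (ContinuousLinearMap.rotation (j * δ) z)).1) := by
  induction m with
  | zero => simp [ContinuousLinearMap.rotation_apply]
  | succ m ih =>
    rw [Finset.sum_range_succ, ← ih]
    have : (ContinuousLinearMap.rotation ((m + 1 : ℕ) * δ) z).1 =
        (ContinuousLinearMap.rotation δ (ContinuousLinearMap.rotation (m * δ) z)).1 := by
      simp only [ContinuousLinearMap.rotation_apply]
      have : ((m + 1 : ℕ) : ℝ) * δ = m * δ + δ := by push_cast; ring
      rw [this, Real.cos_add, Real.sin_add]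
      module
    rw [this]
    ring

theorem lintegral_exp_rotation_le_div (f : E → ℝ) (hf : Measurable f) (α : ℝ) (m : ℕ) :
    ∫⁻ z, ENNReal.ofReal (Real.exp (f z.1 - f (ContinuousLinearMap.rotation α z).1))
        ∂((ProbabilityTheory.stdGaussian E).prod (ProbabilityTheory.stdGaussian E)) ≤
      ∫⁻ z, ENNReal.ofReal (Real.exp (((m + 1 : ℕ) : ℝ) *
          (f z.1 - f (ContinuousLinearMap.rotation (α / (m + 1 : ℕ)) z).1)))
        ∂((ProbabilityTheory.stdGaussian E).prod (ProbabilityTheory.stdGaussian E)) := by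
  set P := (ProbabilityTheory.stdGaussian E).prod (ProbabilityTheory.stdGaussian E)
  set N : ℕ := m + 1 with hN
  have hN0 : (N : ℝ) ≠ 0 := by rw [hN]; positivity
  set δ := α / N
  have hα : α = N * δ := by simp only [δ]; field_simp
  set D : E × E → ℝ := fun z => f z.1 - f (ContinuousLinearMap.rotation δ z).1
  have hrot : ∀ θ, Measurable (fun z : E × E => ContinuousLinearMap.rotation θ z) :=
    fun θ => (ContinuousLinearMap.rotation θ).continuous.measurable
  have hD : Measurable D :=
    (hf.comp measurable_fst).sub (hf.comp (measurable_fst.comp (hrot δ)))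
  have hpt : ∀ z : E × E,
      ENNReal.ofReal (Real.exp (f z.1 - f (ContinuousLinearMap.rotation α z).1)) ≤
      ∑ j ∈ Finset.range N, ENNReal.ofReal (1 / N) *
        ENNReal.ofReal (Real.exp (N * D (ContinuousLinearMap.rotation (j * δ) z))) := by
    intro z
    have h1 := convexOn_exp.map_sum_le (t := Finset.range N) (w := fun _ => (1 / N : ℝ))
      (p := fun j => N * D (ContinuousLinearMap.rotation (j * δ) z))
      (fun _ _ => by positivity) (by simp [hN0]) (fun _ _ => Set.mem_univ _)
    rw [hα, sub_rotation_eq_sum]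
    simp only [smul_eq_mul] at h1
    have h2 : ∑ j ∈ Finset.range N, 1 / (N : ℝ) * (N * D (ContinuousLinearMap.rotation (j * δ) z)) =
        ∑ j ∈ Finset.range N, D (ContinuousLinearMap.rotation (j * δ) z) := by
      refine Finset.sum_congr rfl fun j _ => ?_
      field_simp
    rw [h2] at h1
    refine (ENNReal.ofReal_le_ofReal h1).trans ?_
    rw [ENNReal.ofReal_sum_of_nonneg (fun _ _ => by positivity)]
    refine Finset.sum_le_sum fun j _ => ?_
    rw [ENNReal.ofReal_mul (by positivity)]
  calc _ ≤ ∫⁻ z, ∑ j ∈ Finset.range N, ENNReal.ofReal (1 / N) *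
        ENNReal.ofReal (Real.exp (N * D (ContinuousLinearMap.rotation (j * δ) z))) ∂P :=
        lintegral_mono hpt
    _ = ∑ j ∈ Finset.range N, ENNReal.ofReal (1 / N) *
        ∫⁻ z, ENNReal.ofReal (Real.exp (N * D z)) ∂P := by
      have hm : Measurable fun z => ENNReal.ofReal (Real.exp (N * D z)) := by fun_prop
      have hmr : ∀ j : ℕ, Measurable fun z =>
          ENNReal.ofReal (Real.exp (N * D (ContinuousLinearMap.rotation (j * δ) z))) :=
        fun j => hm.comp (hrot _)
      rw [lintegral_finsetSum _ fun j _ => (hmr j).const_mul _]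
      refine Finset.sum_congr rfl fun j _ => ?_
      rw [lintegral_const_mul _ (hmr j)]
      congr 1
      exact (measurePreserving_rotation_stdGaussian (E := E) (j * δ)).lintegral_comp hm
    _ = _ := by
      rw [Finset.sum_const, Finset.card_range, nsmul_eq_mul, ← mul_assoc]
      rw [show (N : ENNReal) = ENNReal.ofReal N by simp, ← ENNReal.ofReal_mul (by positivity)]
      rw [mul_one_div_cancel hN0, ENNReal.ofReal_one, one_mul]


theorem lintegral_exp_rotation_le {f : E → ℝ} {L : NNReal} (hf : LipschitzWith L f)
    (hac : ∀ᵐ x ∂(ProbabilityTheory.stdGaussian E), DifferentiableAt ℝ f x) (α : ℝ) :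
    ∫⁻ z, ENNReal.ofReal (Real.exp (f z.1 - f (ContinuousLinearMap.rotation α z).1))
        ∂((ProbabilityTheory.stdGaussian E).prod (ProbabilityTheory.stdGaussian E)) ≤
      ENNReal.ofReal (Real.exp (α ^ 2 * L ^ 2 / 2)) := by
  set Γ := ProbabilityTheory.stdGaussian E
  have hfm : Measurable f := hf.continuous.measurable
  have hrot : ∀ θ, Measurable (fun z : E × E => ContinuousLinearMap.rotation θ z) :=
    fun θ => (ContinuousLinearMap.rotation θ).continuous.measurable
  let F : ℕ → E × E → ENNReal := fun m z => ENNReal.ofReal (Real.exp (((m + 1 : ℕ) : ℝ) *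
    (f z.1 - f (ContinuousLinearMap.rotation (α / (m + 1 : ℕ)) z).1)))
  let G : E × E → ENNReal := fun z => ENNReal.ofReal (Real.exp (-(α * fderiv ℝ f z.1 z.2)))
  let K : ℝ := |α| * L
  have hFm : ∀ m, Measurable (F m) := by
    intro m
    have h1 : Measurable fun z : E × E =>
        f (ContinuousLinearMap.rotation (α / (m + 1 : ℕ)) z).1 :=
      hfm.comp (measurable_fst.comp (hrot _))
    have h2 : Measurable fun z : E × E => f z.1 := hfm.comp measurable_fst
    exact ((h2.sub h1).const_mul _).exp.ennreal_ofReal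
  have hbound : ∀ m z, F m z ≤
      ENNReal.ofReal (Real.exp (K * ‖z.1‖)) * ENNReal.ofReal (Real.exp (K * ‖z.2‖)) := by
    intro m z
    rw [← ENNReal.ofReal_mul (by positivity), ← Real.exp_add]
    refine ENNReal.ofReal_le_ofReal (Real.exp_le_exp.2 ?_)
    set N : ℝ := ((m + 1 : ℕ) : ℝ) with hN
    have hN0 : 0 < N := by rw [hN]; positivity
    set δ := α / N
    have h1 : f z.1 - f (ContinuousLinearMap.rotation δ z).1 ≤
        L * ‖z.1 - (ContinuousLinearMap.rotation δ z).1‖ :=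
      (le_abs_self _).trans (hf.norm_sub_le _ _)
    have h2 : ‖z.1 - (ContinuousLinearMap.rotation δ z).1‖ ≤ |δ| * ‖z.1‖ + |δ| * ‖z.2‖ := by
      have : z.1 - (ContinuousLinearMap.rotation δ z).1 =
          (1 - Real.cos δ) • z.1 - Real.sin δ • z.2 := by
        simp only [ContinuousLinearMap.rotation_apply]
        module
      rw [this]
      refine (norm_sub_le _ _).trans ?_
      rw [norm_smul, norm_smul, Real.norm_eq_abs, Real.norm_eq_abs]
      have hs : |Real.sin δ| ≤ |δ| := Real.abs_sin_le_abs
      have hc : |1 - Real.cos δ| ≤ |δ| := by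
        rw [abs_of_nonneg (by linarith [Real.cos_le_one δ])]
        by_cases h : |δ| ≤ 2
        · have := Real.one_sub_sq_div_two_le_cos (x := δ)
          have h3 : δ ^ 2 = |δ| ^ 2 := (sq_abs δ).symm
          nlinarith [abs_nonneg δ]
        · linarith [Real.neg_one_le_cos δ]
      gcongr
    have h3 : N * |δ| = |α| := by
      simp only [δ]
      rw [abs_div, abs_of_pos hN0]
      field_simp
    calc N * (f z.1 - f (ContinuousLinearMap.rotation δ z).1)
        ≤ N * (L * (|δ| * ‖z.1‖ + |δ| * ‖z.2‖)) := by gcongr; exact h1.trans (by gcongr)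
      _ = (N * |δ|) * L * ‖z.1‖ + (N * |δ|) * L * ‖z.2‖ := by ring
      _ = K * ‖z.1‖ + K * ‖z.2‖ := by rw [h3]
  have hfin : ∫⁻ z : E × E, ENNReal.ofReal (Real.exp (K * ‖z.1‖)) *
      ENNReal.ofReal (Real.exp (K * ‖z.2‖)) ∂(Γ.prod Γ) ≠ ⊤ := by
    rw [lintegral_prod_mul (f := fun x : E => ENNReal.ofReal (Real.exp (K * ‖x‖)))
      (g := fun x : E => ENNReal.ofReal (Real.exp (K * ‖x‖))) (by fun_prop) (by fun_prop)]
    exact (ENNReal.mul_lt_top (lintegral_exp_mul_norm_stdGaussian_lt_top K)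
      (lintegral_exp_mul_norm_stdGaussian_lt_top K)).ne
  have hlim : ∀ᵐ z ∂(Γ.prod Γ), Filter.Tendsto (fun m => F m z) Filter.atTop (nhds (G z)) := by
    have hae : ∀ᵐ z ∂(Γ.prod Γ), DifferentiableAt ℝ f z.1 :=
      Measure.quasiMeasurePreserving_fst.ae hac
    filter_upwards [hae] with z hz
    refine ENNReal.tendsto_ofReal ((Real.continuous_exp.tendsto _).comp ?_)
    have hd : HasDerivAt (fun t : ℝ => (ContinuousLinearMap.rotation (α * t) z).1)
        (α • z.2) 0 := by
      simp only [ContinuousLinearMap.rotation_apply]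
      have hl : HasDerivAt (fun t : ℝ => α * t) α 0 := by
        simpa using (hasDerivAt_id (0 : ℝ)).const_mul α
      have hc := (hl.cos.smul_const z.1).add (hl.sin.smul_const z.2)
      have e : (-Real.sin (α * 0) * α) • z.1 + (Real.cos (α * 0) * α) • z.2 = α • z.2 := by simp
      rw [← e]
      exact hc
    have hz' : HasFDerivAt f (fderiv ℝ f z.1) (ContinuousLinearMap.rotation (α * 0) z).1 := by
      simpa [ContinuousLinearMap.rotation_apply] using hz.hasFDerivAt
    have hcomp := (hz'.comp_hasDerivAt (0 : ℝ) hd).tendsto_slope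
    have hseq : Filter.Tendsto (fun m : ℕ => (1 / ((m + 1 : ℕ) : ℝ))) Filter.atTop
        (nhdsWithin 0 {0}ᶜ) := by
      rw [tendsto_nhdsWithin_iff]
      refine ⟨by simpa using tendsto_one_div_add_atTop_nhds_zero_nat (𝕜 := ℝ), ?_⟩
      exact Filter.Eventually.of_forall fun m => by
        simp only [Set.mem_compl_iff, Set.mem_singleton_iff]
        positivity
    have h5 := (hcomp.comp hseq).neg
    have : (-(fderiv ℝ f z.1) (α • z.2)) = -(α * fderiv ℝ f z.1 z.2) := by simp
    rw [this] at h5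
    refine h5.congr fun m => ?_
    simp only [Function.comp_apply, slope_def_field]
    have hN0 : ((m + 1 : ℕ) : ℝ) ≠ 0 := by positivity
    have e1 : (ContinuousLinearMap.rotation (α * 0) z).1 = z.1 := by
      simp [ContinuousLinearMap.rotation_apply]
    rw [e1, mul_one_div]
    field_simp
    ring
  have htend := tendsto_lintegral_of_dominated_convergence' _ (fun m => (hFm m).aemeasurable)
    (fun m => ae_of_all (Γ.prod Γ) (hbound m)) hfin hlim
  have hle : ∀ m, ∫⁻ z, ENNReal.ofReal (Real.exp (f z.1 -
      f (ContinuousLinearMap.rotation α z).1)) ∂(Γ.prod Γ) ≤ ∫⁻ z, F m z ∂(Γ.prod Γ) :=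
    fun m => lintegral_exp_rotation_le_div f hfm α m
  refine (ge_of_tendsto' htend hle).trans ?_
  have hG : AEMeasurable G (Γ.prod Γ) :=
    aemeasurable_of_tendsto_metrizable_ae Filter.atTop (fun m => (hFm m).aemeasurable) hlim
  rw [lintegral_prod _ hG]
  calc ∫⁻ x, ∫⁻ y, G (x, y) ∂Γ ∂Γ
      ≤ ∫⁻ x, ENNReal.ofReal (Real.exp (α ^ 2 * L ^ 2 / 2)) ∂Γ := by
        refine lintegral_mono fun x => ?_
        have := lintegral_exp_dual_stdGaussian (-(α • fderiv ℝ f x))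
        have e : ∀ y, (-(α • fderiv ℝ f x)) y = -(α * fderiv ℝ f x y) := fun y => by simp
        simp only [e] at this
        simp only [G]
        rw [this]
        refine ENNReal.ofReal_le_ofReal (Real.exp_le_exp.2 ?_)
        rw [norm_neg, norm_smul, mul_pow, Real.norm_eq_abs, sq_abs]
        have := norm_fderiv_le_of_lipschitz ℝ hf (x₀ := x)
        gcongr
    _ = _ := by simp

end Rotation

section Law

open scoped RealInnerProductSpace

theorem comp_innerSL_prod {V : Type*} [NormedAddCommGroup V] [InnerProductSpace ℝ V]
    (ℓ : StrongDual ℝ (ℝ × ℝ)) (u v : V) :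
    ℓ ∘SL ((innerSL ℝ u).prod (innerSL ℝ v)) = innerSL ℝ (ℓ (1, 0) • u + ℓ (0, 1) • v) := by
  ext w
  have : ((⟪u, w⟫, ⟪v, w⟫) : ℝ × ℝ) = ⟪u, w⟫ • ((1, 0) : ℝ × ℝ) + ⟪v, w⟫ • ((0, 1) : ℝ × ℝ) := by
    simp
  simp only [ContinuousLinearMap.comp_apply, ContinuousLinearMap.prod_apply, innerSL_apply_apply]
  rw [this, map_add, map_smul, map_smul, inner_add_left, real_inner_smul_left,
    real_inner_smul_left, smul_eq_mul, smul_eq_mul]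
  ring

theorem map_inner_pair_stdGaussian_congr {E F : Type*} [NormedAddCommGroup E]
    [InnerProductSpace ℝ E] [FiniteDimensional ℝ E] [MeasurableSpace E] [BorelSpace E]
    [NormedAddCommGroup F] [InnerProductSpace ℝ F] [FiniteDimensional ℝ F] [MeasurableSpace F]
    [BorelSpace F] {x y : E} {x' y' : F} (hx : ‖x‖ = ‖x'‖) (hy : ‖y‖ = ‖y'‖)
    (hxy : ⟪x, y⟫ = ⟪x', y'⟫) :
    (ProbabilityTheory.stdGaussian E).map ((innerSL ℝ x).prod (innerSL ℝ y)) =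
      (ProbabilityTheory.stdGaussian F).map ((innerSL ℝ x').prod (innerSL ℝ y')) := by
  have h1 : IsProbabilityMeasure ((ProbabilityTheory.stdGaussian E).map
      ((innerSL ℝ x).prod (innerSL ℝ y))) :=
    Measure.isProbabilityMeasure_map (by fun_prop)
  have h2 : IsProbabilityMeasure ((ProbabilityTheory.stdGaussian F).map
      ((innerSL ℝ x').prod (innerSL ℝ y'))) :=
    Measure.isProbabilityMeasure_map (by fun_prop)
  refine Measure.ext_of_charFunDual ?_
  ext ℓ
  rw [charFunDual_map, charFunDual_map, charFunDual_stdGaussian, charFunDual_stdGaussian]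
  have e : ‖ℓ (1, 0) • x + ℓ (0, 1) • y‖ ^ 2 = ‖ℓ (1, 0) • x' + ℓ (0, 1) • y'‖ ^ 2 := by
    rw [norm_add_sq_real, norm_add_sq_real]
    simp only [norm_smul, real_inner_smul_left, real_inner_smul_right, hx, hy, hxy]
  rw [comp_innerSL_prod, comp_innerSL_prod, innerSL_apply_norm, innerSL_apply_norm, ← Complex.ofReal_pow, e,
    Complex.ofReal_pow]

theorem map_pair_pi_gaussianReal {k : ℕ} {x y : EuclideanSpace ℝ (Fin k)} (hx : ‖x‖ = 1)
    (hy : ‖y‖ = 1) {α : ℝ} (hxy : ⟪x, y⟫ = Real.cos α) :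
    (Measure.pi fun _ : Fin k => gaussianReal 0 1).map
        (fun r => (∑ j, r j * x j, ∑ j, r j * y j)) =
      ((gaussianReal 0 1).prod (gaussianReal 0 1)).map
        (fun z : ℝ × ℝ => (z.1, Real.cos α * z.1 + Real.sin α * z.2)) := by
  have hpi : ∀ {m : ℕ} (u v : EuclideanSpace ℝ (Fin m)),
      (Measure.pi fun _ : Fin m => gaussianReal 0 1).map
        (fun r => (∑ j, r j * u j, ∑ j, r j * v j)) =
      (ProbabilityTheory.stdGaussian (EuclideanSpace ℝ (Fin m))).map
        ((innerSL ℝ u).prod (innerSL ℝ v)) := by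
    intro m u v
    rw [← map_pi_eq_stdGaussian, Measure.map_map (by fun_prop) (by fun_prop)]
    congr 1
  rw [hpi, ← (measurePreserving_finTwoArrow (gaussianReal 0 1)).map_eq,
    Measure.map_map (by fun_prop) (by fun_prop),
    map_inner_pair_stdGaussian_congr (x' := !₂[(1 : ℝ), 0]) (y' := !₂[Real.cos α, Real.sin α]),
    ← hpi]
  · congr 1
    ext r <;> simp [MeasurableEquiv.finTwoArrow, mul_comm]
  · simp [EuclideanSpace.norm_eq, hx]
  · simp [EuclideanSpace.norm_eq, hy]
  · simp [PiLp.inner_apply, hxy]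

/-- The product `Gx` as an element of Euclidean space. -/
noncomputable def mulVecE {n k : ℕ} (g : Fin n → Fin k → ℝ) (x : EuclideanSpace ℝ (Fin k)) :
    EuclideanSpace ℝ (Fin n) :=
  WithLp.toLp 2 (mulVec g x)

theorem measurable_mulVecE {n k : ℕ} (x : EuclideanSpace ℝ (Fin k)) :
    Measurable fun g : Fin n → Fin k → ℝ => mulVecE g x := by
  unfold mulVecE mulVec
  fun_prop

theorem map_mulVecE_pair {n k : ℕ} {x y : EuclideanSpace ℝ (Fin k)} (hx : ‖x‖ = 1)
    (hy : ‖y‖ = 1) {α : ℝ} (hxy : ⟪x, y⟫ = Real.cos α) :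
    (gaussMatrix n k).map (fun g => (mulVecE g x, mulVecE g y)) =
      ((ProbabilityTheory.stdGaussian (EuclideanSpace ℝ (Fin n))).prod
        (ProbabilityTheory.stdGaussian (EuclideanSpace ℝ (Fin n)))).map
        (fun z => (z.1, (ContinuousLinearMap.rotation α z).1)) := by
  let γ := gaussianReal 0 1
  let toE : (Fin n → ℝ × ℝ) → EuclideanSpace ℝ (Fin n) × EuclideanSpace ℝ (Fin n) :=
    fun w => (WithLp.toLp 2 fun i => (w i).1, WithLp.toLp 2 fun i => (w i).2)
  have htoE : Measurable toE := by
    simp only [toE]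
    fun_prop
  have hprob : IsProbabilityMeasure ((Measure.pi fun _ : Fin k => gaussianReal 0 1).map
      (fun r => (∑ j, r j * x j, ∑ j, r j * y j))) :=
    Measure.isProbabilityMeasure_map (by fun_prop)
  have hprob' : IsProbabilityMeasure ((γ.prod γ).map
      (fun z : ℝ × ℝ => (z.1, Real.cos α * z.1 + Real.sin α * z.2))) :=
    Measure.isProbabilityMeasure_map (by fun_prop)
  have h1 : (gaussMatrix n k).map (fun g => (mulVecE g x, mulVecE g y)) =
      (Measure.pi fun _ : Fin n => (Measure.pi fun _ : Fin k => gaussianReal 0 1).map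
        (fun r => (∑ j, r j * x j, ∑ j, r j * y j))).map toE := by
    rw [← Measure.pi_map_pi (fun i => by fun_prop), Measure.map_map htoE (by fun_prop)]
    rfl
  have h2 : (ProbabilityTheory.stdGaussian (EuclideanSpace ℝ (Fin n))).prod
      (ProbabilityTheory.stdGaussian (EuclideanSpace ℝ (Fin n))) =
      (Measure.pi fun _ : Fin n => γ.prod γ).map toE := by
    rw [← map_pi_eq_stdGaussian, Measure.map_prod_map _ _ (by fun_prop) (by fun_prop),
      ← (measurePreserving_arrowProdEquivProdArrow ℝ ℝ (Fin n) (fun _ => γ) (fun _ => γ)).map_eq,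
      Measure.map_map (by fun_prop) (by fun_prop)]
    rfl
  rw [h1, h2, Measure.map_map (by fun_prop) htoE]
  simp_rw [map_pair_pi_gaussianReal hx hy hxy]
  rw [← Measure.pi_map_pi (fun i => by fun_prop), Measure.map_map htoE (by fun_prop)]
  rfl

theorem map_mulVecE {n k : ℕ} {x : EuclideanSpace ℝ (Fin k)} (hx : ‖x‖ = 1) :
    (gaussMatrix n k).map (fun g => mulVecE g x) =
      ProbabilityTheory.stdGaussian (EuclideanSpace ℝ (Fin n)) := by
  have h := map_mulVecE_pair (n := n) hx hx (α := 0) (by simp [hx])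
  have h' := congrArg (Measure.map Prod.fst) h
  rw [Measure.map_map measurable_fst ((measurable_mulVecE x).prodMk (measurable_mulVecE x)),
    Measure.map_map measurable_fst (by fun_prop)] at h'
  refine h'.trans ?_
  exact measurePreserving_fst.map_eq

end Law

section Tail

open scoped RealInnerProductSpace

theorem ae_differentiableAt_stdGaussian {n : ℕ} {f : EuclideanSpace ℝ (Fin n) → ℝ} {L : NNReal}
    (hf : LipschitzWith L f) :
    ∀ᵐ x ∂(ProbabilityTheory.stdGaussian (EuclideanSpace ℝ (Fin n))), DifferentiableAt ℝ f x :=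
  (stdGaussian_euclidean_absolutelyContinuous n).ae_le (hf.ae_differentiableAt (μ := volume))

theorem measure_sub_rotation_ge_le {n : ℕ} {f : EuclideanSpace ℝ (Fin n) → ℝ} {L : NNReal}
    (hf : LipschitzWith L f) {α σ s : ℝ} (hσ : 0 < σ) (hα : |α| * L ≤ σ) (hs : 0 ≤ s) :
    ((ProbabilityTheory.stdGaussian (EuclideanSpace ℝ (Fin n))).prod
        (ProbabilityTheory.stdGaussian (EuclideanSpace ℝ (Fin n))))
      {z | s * σ ≤ f z.1 - f (ContinuousLinearMap.rotation α z).1} ≤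
      ENNReal.ofReal (Real.exp (-(s ^ 2 / 2))) := by
  set Γ := ProbabilityTheory.stdGaussian (EuclideanSpace ℝ (Fin n))
  have hl : 0 ≤ s / σ := by positivity
  have hfl : LipschitzWith ((s / σ).toNNReal * L) fun x => s / σ * f x := by
    refine LipschitzWith.of_dist_le_mul fun x y => ?_
    rw [Real.dist_eq, ← mul_sub, abs_mul, abs_of_nonneg hl, NNReal.coe_mul,
      Real.coe_toNNReal _ hl, mul_assoc]
    gcongr
    exact hf.dist_le_mul x y
  have hInt := lintegral_exp_rotation_le hfl (ae_differentiableAt_stdGaussian hfl) α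
  have hmeas : Measurable fun z : EuclideanSpace ℝ (Fin n) × EuclideanSpace ℝ (Fin n) =>
      ENNReal.ofReal (Real.exp (s / σ * f z.1 -
        s / σ * f (ContinuousLinearMap.rotation α z).1)) := by
    have h0 : Measurable f := hf.continuous.measurable
    have h1 : Measurable fun z : EuclideanSpace ℝ (Fin n) × EuclideanSpace ℝ (Fin n) =>
        f (ContinuousLinearMap.rotation α z).1 :=
      h0.comp (measurable_fst.comp (ContinuousLinearMap.rotation α).continuous.measurable)
    have h2 : Measurable fun z : EuclideanSpace ℝ (Fin n) × EuclideanSpace ℝ (Fin n) => f z.1 :=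
      h0.comp measurable_fst
    exact ((h2.const_mul _).sub (h1.const_mul _)).exp.ennreal_ofReal
  have hmk := meas_ge_le_lintegral_div hmeas.aemeasurable (μ := Γ.prod Γ)
    (ε := ENNReal.ofReal (Real.exp (s ^ 2))) (by simp [Real.exp_pos]) (by simp)
  calc _ ≤ (Γ.prod Γ) {z | ENNReal.ofReal (Real.exp (s ^ 2)) ≤ ENNReal.ofReal (Real.exp
          (s / σ * f z.1 - s / σ * f (ContinuousLinearMap.rotation α z).1))} := by
        refine measure_mono fun z hz => ?_
        simp only [Set.mem_ofPred_eq] at hz ⊢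
        refine ENNReal.ofReal_le_ofReal (Real.exp_le_exp.2 ?_)
        rw [← mul_sub]
        calc s ^ 2 = s / σ * (s * σ) := by field_simp
          _ ≤ _ := by gcongr
    _ ≤ _ := hmk
    _ ≤ ENNReal.ofReal (Real.exp (α ^ 2 * ((s / σ).toNNReal * L : NNReal) ^ 2 / 2)) /
          ENNReal.ofReal (Real.exp (s ^ 2)) := by gcongr
    _ ≤ _ := by
      rw [← ENNReal.ofReal_div_of_pos (Real.exp_pos _), ← Real.exp_sub]
      refine ENNReal.ofReal_le_ofReal (Real.exp_le_exp.2 ?_)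
      rw [NNReal.coe_mul, Real.coe_toNNReal _ hl]
      have h3 : (|α| * L) ^ 2 ≤ σ ^ 2 := by gcongr
      have : α ^ 2 * (s / σ * L) ^ 2 = (|α| * L) ^ 2 * (s / σ) ^ 2 := by
        rw [mul_pow |α|, sq_abs]; ring
      rw [this]
      have h4 : (|α| * L) ^ 2 * (s / σ) ^ 2 ≤ σ ^ 2 * (s / σ) ^ 2 := by gcongr
      have h5 : σ ^ 2 * (s / σ) ^ 2 = s ^ 2 := by field_simp
      linarith

theorem arccos_inner_le {E : Type*} [NormedAddCommGroup E] [InnerProductSpace ℝ E] {x y : E}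
    (hx : ‖x‖ = 1) (hy : ‖y‖ = 1) : Real.arccos ⟪x, y⟫ ≤ Real.pi / 2 * ‖x - y‖ := by
  set α := Real.arccos ⟪x, y⟫ with hα
  have h0 : 0 ≤ α := Real.arccos_nonneg _
  have h1 : α ≤ Real.pi := Real.arccos_le_pi _
  have hab := abs_real_inner_le_norm x y
  rw [hx, hy, mul_one, abs_le] at hab
  have hc : Real.cos α = ⟪x, y⟫ := Real.cos_arccos hab.1 hab.2
  have h2 : 2 / Real.pi * (α / 2) ≤ Real.sin (α / 2) :=
    Real.mul_le_sin (by linarith) (by linarith)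
  have h3 : ‖x - y‖ ^ 2 = (2 * Real.sin (α / 2)) ^ 2 := by
    rw [norm_sub_sq_real, hx, hy, ← hc, mul_pow, Real.sin_sq_eq_half_sub]
    ring_nf
  have hs : 0 ≤ Real.sin (α / 2) :=
    Real.sin_nonneg_of_nonneg_of_le_pi (by linarith) (by linarith)
  have h4 : ‖x - y‖ = 2 * Real.sin (α / 2) :=
    (pow_left_inj₀ (norm_nonneg _) (by linarith) two_ne_zero).1 h3
  rw [h4]
  have hpi := Real.pi_pos
  calc α = Real.pi / 2 * (2 * (2 / Real.pi * (α / 2))) := by field_simp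
    _ ≤ _ := by gcongr

theorem gaussMatrix_sub_ge_le {n k : ℕ} {f : EuclideanSpace ℝ (Fin n) → ℝ} {L : NNReal}
    (hf : LipschitzWith L f) {x y : EuclideanSpace ℝ (Fin k)} (hx : ‖x‖ = 1) (hy : ‖y‖ = 1)
    {σ s : ℝ} (hσ : 0 < σ) (hxy : Real.pi / 2 * ‖x - y‖ * L ≤ σ) (hs : 0 ≤ s) :
    gaussMatrix n k {g | s * σ ≤ f (mulVecE g x) - f (mulVecE g y)} ≤
      ENNReal.ofReal (Real.exp (-(s ^ 2 / 2))) := by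
  set α := Real.arccos ⟪x, y⟫ with hα
  have hab := abs_real_inner_le_norm x y
  rw [hx, hy, mul_one, abs_le] at hab
  have hc : ⟪x, y⟫ = Real.cos α := (Real.cos_arccos hab.1 hab.2).symm
  have hfm : Measurable f := hf.continuous.measurable
  have hms : MeasurableSet {z : EuclideanSpace ℝ (Fin n) × EuclideanSpace ℝ (Fin n) |
      s * σ ≤ f z.1 - f z.2} :=
    measurableSet_le measurable_const
      ((hfm.comp measurable_fst).sub (hfm.comp measurable_snd))
  have h := congrArg (fun m => m {z | s * σ ≤ f z.1 - f z.2}) (map_mulVecE_pair (n := n) hx hy hc)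
  simp only at h
  rw [Measure.map_apply ((measurable_mulVecE x).prodMk (measurable_mulVecE y)) hms,
    Measure.map_apply (by fun_prop) hms] at h
  refine h.le.trans (measure_sub_rotation_ge_le hf hσ ?_ hs)
  rw [abs_of_nonneg (Real.arccos_nonneg _)]
  exact (mul_le_mul_of_nonneg_right (arccos_inner_le hx hy) L.2).trans hxy

theorem gaussMatrix_abs_sub_ge_le {n k : ℕ} {f : EuclideanSpace ℝ (Fin n) → ℝ} {L : NNReal}
    (hf : LipschitzWith L f) {x y : EuclideanSpace ℝ (Fin k)} (hx : ‖x‖ = 1) (hy : ‖y‖ = 1)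
    {σ s : ℝ} (hσ : 0 < σ) (hxy : Real.pi / 2 * ‖x - y‖ * L ≤ σ) (hs : 0 ≤ s) :
    gaussMatrix n k {g | s * σ ≤ |f (mulVecE g x) - f (mulVecE g y)|} ≤
      2 * ENNReal.ofReal (Real.exp (-(s ^ 2 / 2))) := by
  have h1 := gaussMatrix_sub_ge_le hf hx hy hσ hxy hs
  have h2 := gaussMatrix_sub_ge_le hf hy hx hσ (by rwa [norm_sub_rev]) hs
  refine (measure_mono ?_).trans ((measure_union_le _ _).trans ((add_le_add h1 h2).trans_eq
    (two_mul _).symm))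
  intro g hg
  simp only [Set.mem_ofPred_eq, Set.mem_union] at hg ⊢
  rcases abs_cases (f (mulVecE g x) - f (mulVecE g y)) with h | h
  · left; linarith [h.1]
  · right; linarith [h.1]

theorem exists_stdGaussian_abs_sub_ge_le {n : ℕ} {f : EuclideanSpace ℝ (Fin n) → ℝ} {L : NNReal}
    (hf : LipschitzWith L f) {σ s : ℝ} (hσ : 0 < σ) (hL : Real.pi / 2 * L ≤ σ) (hs : 0 ≤ s) :
    ∃ m : ℝ, ProbabilityTheory.stdGaussian (EuclideanSpace ℝ (Fin n)) {u | s * σ ≤ |f u - m|} ≤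
      2 * ENNReal.ofReal (Real.exp (-(s ^ 2 / 2))) := by
  set Γ := ProbabilityTheory.stdGaussian (EuclideanSpace ℝ (Fin n))
  have hfm : Measurable f := hf.continuous.measurable
  have hms : MeasurableSet {z : EuclideanSpace ℝ (Fin n) × EuclideanSpace ℝ (Fin n) |
      s * σ ≤ |f z.2 - f z.1|} :=
    measurableSet_le measurable_const
      ((hfm.comp measurable_snd).sub (hfm.comp measurable_fst)).abs
  have h1 : (Γ.prod Γ) {z | s * σ ≤ |f z.2 - f z.1|} ≤
      2 * ENNReal.ofReal (Real.exp (-(s ^ 2 / 2))) := by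
    have ha := measure_sub_rotation_ge_le hf (α := Real.pi / 2) hσ
      (by rwa [abs_of_pos (by positivity)]) hs
    have hb := measure_sub_rotation_ge_le hf.neg (α := Real.pi / 2) hσ
      (by rwa [abs_of_pos (by positivity)]) hs
    refine (measure_mono ?_).trans ((measure_union_le _ _).trans ((add_le_add ha hb).trans_eq
      (two_mul _).symm))
    intro z hz
    simp only [Set.mem_ofPred_eq, Set.mem_union, ContinuousLinearMap.rotation_apply,
      Real.cos_pi_div_two, Real.sin_pi_div_two, zero_smul, one_smul, zero_add, Pi.neg_apply]
      at hz ⊢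
    rcases abs_cases (f z.2 - f z.1) with h | h
    · right; linarith [h.1]
    · left; linarith [h.1]
  rw [Measure.prod_apply hms] at h1
  obtain ⟨a, ha⟩ := exists_le_lintegral (μ := Γ) (measurable_measure_prodMk_left (ν := Γ) hms).aemeasurable
  exact ⟨f a, ha.trans h1⟩

end Tail

section Nets

open Module in
theorem card_le_of_separated_sphere {E : Type*} [NormedAddCommGroup E] [NormedSpace ℝ E]
    [FiniteDimensional ℝ E] {δ : ℝ} (hδ : 0 < δ) (hδ1 : δ ≤ 1) (s : Finset E)
    (hs : ∀ c ∈ s, ‖c‖ = 1) (h : ∀ c ∈ s, ∀ d ∈ s, c ≠ d → δ ≤ ‖c - d‖) :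
    (s.card : ℝ) ≤ (3 / δ) ^ finrank ℝ E := by
  borelize E
  let μ : Measure E := Measure.addHaar
  have ρpos : (0 : ℝ) < 3 / 2 := by norm_num
  have δpos : 0 < δ / 2 := by positivity
  set A := ⋃ c ∈ s, Metric.ball (c : E) (δ / 2) with hA
  have D : Set.Pairwise (s : Set E) (Function.onFun Disjoint fun c => Metric.ball c (δ / 2)) := by
    rintro c hc d hd hcd
    apply Metric.ball_disjoint_ball
    rw [dist_eq_norm]
    linarith [h c hc d hd hcd]
  have A_subset : A ⊆ Metric.ball (0 : E) (3 / 2) := by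
    refine Set.iUnion₂_subset fun x hx => Metric.ball_subset_ball' ?_
    rw [dist_zero_right, hs x hx]
    linarith
  have I : (s.card : ENNReal) * ENNReal.ofReal ((δ / 2) ^ finrank ℝ E) * μ (Metric.ball 0 1) ≤
      ENNReal.ofReal ((3 / 2) ^ finrank ℝ E) * μ (Metric.ball 0 1) :=
    calc
      _ = μ A := by
        rw [hA, measure_biUnion_finset D fun c _ => measurableSet_ball]
        simp only [μ.addHaar_ball_of_pos _ δpos]
        simp only [Finset.sum_const, nsmul_eq_mul, mul_assoc]
      _ ≤ μ (Metric.ball (0 : E) (3 / 2)) := measure_mono A_subset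
      _ = _ := by simp only [μ.addHaar_ball_of_pos _ ρpos]
  have J := (ENNReal.mul_le_mul_iff_left
    (Metric.measure_ball_pos μ (0 : E) zero_lt_one).ne' measure_ball_lt_top.ne).1 I
  have K := ENNReal.toReal_le_of_le_ofReal (pow_nonneg ρpos.le _) J
  rw [ENNReal.toReal_mul, ENNReal.toReal_natCast, ENNReal.toReal_ofReal (by positivity)] at K
  rw [show (3 : ℝ) / δ = (3 / 2) / (δ / 2) by field_simp, div_pow, le_div_iff₀ (by positivity)]
  exact K

open Module in
theorem exists_net_sphere {E : Type*} [NormedAddCommGroup E] [NormedSpace ℝ E]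
    [FiniteDimensional ℝ E] {δ : ℝ} (hδ : 0 < δ) (hδ1 : δ ≤ 1) :
    ∃ s : Finset E, (∀ c ∈ s, ‖c‖ = 1) ∧ (s.card : ℝ) ≤ (3 / δ) ^ finrank ℝ E ∧
      ∀ x : E, ‖x‖ = 1 → ∃ c ∈ s, ‖x - c‖ ≤ δ := by
  classical
  let P : Finset E → Prop := fun s => (∀ c ∈ s, ‖c‖ = 1) ∧
    ∀ c ∈ s, ∀ d ∈ s, c ≠ d → δ ≤ ‖c - d‖
  let S : Set ℕ := {m | ∃ s, P s ∧ s.card = m}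
  have hne : S.Nonempty := ⟨0, ∅, by simp [P], rfl⟩
  have hbd : BddAbove S := by
    refine ⟨⌊(3 / δ) ^ finrank ℝ E⌋₊, ?_⟩
    rintro _ ⟨s, hs, rfl⟩
    exact Nat.le_floor (card_le_of_separated_sphere hδ hδ1 s hs.1 hs.2)
  obtain ⟨s, hs, hcard⟩ := Nat.sSup_mem hne hbd
  refine ⟨s, hs.1, card_le_of_separated_sphere hδ hδ1 s hs.1 hs.2, fun x hx => ?_⟩
  by_contra! hc
  have hxs : x ∉ s := fun hxs => by
    have := hc x hxs
    simp at this
    linarith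
  have hP : P (insert x s) := by
    refine ⟨fun c hc' => ?_, fun c hc' d hd hcd => ?_⟩
    · rcases Finset.mem_insert.1 hc' with rfl | h
      exacts [hx, hs.1 c h]
    · rcases Finset.mem_insert.1 hc' with rfl | h <;> rcases Finset.mem_insert.1 hd with rfl | h'
      · exact absurd rfl hcd
      · exact (hc d h').le
      · rw [norm_sub_rev]; exact (hc c h).le
      · exact hs.2 c h d h' hcd
  have := le_csSup hbd (show (insert x s).card ∈ S from ⟨_, hP, rfl⟩)
  rw [← hcard, Finset.card_insert_of_notMem hxs] at this
  omega

end Nets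

section Chaining

theorem continuous_mulVecE {n k : ℕ} (g : Fin n → Fin k → ℝ) :
    Continuous fun x : EuclideanSpace ℝ (Fin k) => mulVecE g x := by
  unfold mulVecE mulVec
  fun_prop

theorem exp_le_half_pow_of_chaining {d : ℝ} (hd : 1 ≤ d) (j : ℕ) :
    Real.exp (3 * (j + 1) * d) * Real.exp (-((4 * Real.sqrt d * (j + 1)) ^ 2 / 2)) ≤
      Real.exp (-(2 * d)) * (1 / 8 * (1 / 2) ^ j) := by
  have hj : (0 : ℝ) ≤ j := j.cast_nonneg
  have h0 : Real.exp (-3 : ℝ) ≤ 1 / 8 := by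
    rw [Real.exp_neg, ← one_div]
    refine one_div_le_one_div_of_le (by norm_num) ?_
    have h1 : (2 : ℝ) ≤ Real.exp 1 := by linarith [Real.add_one_le_exp (1 : ℝ)]
    calc (8 : ℝ) = 2 ^ 3 := by norm_num
      _ ≤ Real.exp 1 ^ 3 := by gcongr
      _ = Real.exp 3 := by rw [← Real.exp_nat_mul]; norm_num
  have h1 : Real.exp (-3 * ((j : ℝ) + 1)) ≤ 1 / 8 * (1 / 2) ^ j := by
    have : Real.exp (-3 * ((j : ℝ) + 1)) = Real.exp (-3) ^ (j + 1) := by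
      rw [← Real.exp_nat_mul]; push_cast; ring_nf
    rw [this, pow_succ']
    gcongr
    exact h0.trans (by norm_num)
  calc _ = Real.exp (3 * (j + 1) * d + -((4 * Real.sqrt d * (j + 1)) ^ 2 / 2)) := by
        rw [Real.exp_add]
    _ ≤ Real.exp (-(2 * d) + -3 * (j + 1)) := by
        refine Real.exp_le_exp.2 ?_
        have : (4 * Real.sqrt d * (j + 1)) ^ 2 = 16 * d * (j + 1) ^ 2 := by
          rw [mul_pow, mul_pow, Real.sq_sqrt (by linarith)]; norm_num
        rw [this]
        nlinarith [mul_nonneg hj hj, mul_nonneg hj (by linarith : 0 ≤ d),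
          mul_nonneg (mul_nonneg hj hj) (by linarith : 0 ≤ d)]
    _ = Real.exp (-(2 * d)) * Real.exp (-3 * (j + 1)) := Real.exp_add _ _
    _ ≤ _ := by gcongr

theorem three_mul_two_pow_le_exp (j : ℕ) :
    (3 * 2 ^ j : ℝ) * (3 * 2 ^ (j + 1)) ≤ Real.exp (3 * (j + 1)) := by
  have h : (18 : ℝ) ≤ Real.exp 3 := by
    have h1 : (2.7 : ℝ) ≤ Real.exp 1 := by linarith [Real.exp_one_gt_d9]
    calc (18 : ℝ) ≤ 2.7 ^ 3 := by norm_num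
      _ ≤ Real.exp 1 ^ 3 := by gcongr
      _ = Real.exp 3 := by rw [← Real.exp_nat_mul]; norm_num
  calc (3 * 2 ^ j : ℝ) * (3 * 2 ^ (j + 1)) = 18 * 4 ^ j := by
        rw [show (4 : ℝ) = 2 * 2 by norm_num, mul_pow]; ring
    _ ≤ 18 * 18 ^ j := by gcongr; norm_num
    _ = 18 ^ (j + 1) := by ring
    _ ≤ Real.exp 3 ^ (j + 1) := by gcongr
    _ = _ := by rw [← Real.exp_nat_mul]; push_cast; ring_nf

theorem measure_biUnion_finset_le_mul {α ι : Type*} [MeasurableSpace α] (μ : Measure α)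
    (s : Finset ι) (A : ι → Set α) {N b : ℝ} (hN : (s.card : ℝ) ≤ N)
    (h : ∀ i ∈ s, μ (A i) ≤ ENNReal.ofReal b) :
    μ (⋃ i ∈ s, A i) ≤ ENNReal.ofReal (N * b) := by
  refine (measure_biUnion_finset_le s A).trans ((Finset.sum_le_card_nsmul _ _ _ h).trans ?_)
  rw [nsmul_eq_mul, ENNReal.ofReal_mul ((Nat.cast_nonneg _).trans hN)]
  gcongr
  rw [← ENNReal.ofReal_natCast]
  exact ENNReal.ofReal_le_ofReal hN

theorem abs_sub_le_of_chain {F : ℕ → ℝ} {m K l : ℝ} (h0 : |F 0 - m| ≤ 2 * K)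
    (h : ∀ j : ℕ, |F j - F (j + 1)| ≤ 4 * ((j : ℝ) + 1) * (1 / 2) ^ j * K) (hK : 0 ≤ K)
    (hl : Filter.Tendsto F Filter.atTop (nhds l)) : |l - m| ≤ 18 * K := by
  have h1 : ∀ j : ℕ, |F j - m| ≤ (18 - 8 * ((j : ℝ) + 2) * (1 / 2) ^ j) * K := by
    intro j
    induction j with
    | zero => refine h0.trans (le_of_eq ?_); norm_num
    | succ j ih =>
      have h2 : |F (j + 1) - m| ≤ |F j - F (j + 1)| + |F j - m| := by
        rw [abs_sub_comm (F j) (F (j + 1))]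
        exact abs_sub_le _ _ _
      refine h2.trans ((add_le_add (h j) ih).trans (le_of_eq ?_))
      push_cast
      ring
  refine le_of_tendsto ((hl.sub_const m).abs) (Filter.Eventually.of_forall fun j => ?_)
  refine (h1 j).trans ?_
  gcongr
  have : 0 ≤ 8 * ((j : ℝ) + 2) * (1 / 2) ^ j := by positivity
  linarith

theorem exists_gaussMatrix_abs_sub_gt_le {n k : ℕ} {d : ℝ} (hd : 1 ≤ d) (hkd : k ≤ d)
    {f : EuclideanSpace ℝ (Fin n) → ℝ} {L : NNReal} (hL : 0 < L) (hf : LipschitzWith L f) :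
    ∃ m : ℝ, ProbabilityTheory.stdGaussian (EuclideanSpace ℝ (Fin n))
        {u | 60 * L * Real.sqrt d < |f u - m|} ≤ ENNReal.ofReal (Real.exp (-(2 * d))) ∧
      gaussMatrix n k {g | ∃ x : EuclideanSpace ℝ (Fin k), ‖x‖ = 1 ∧
        60 * L * Real.sqrt d < |f (mulVecE g x) - m|} ≤ ENNReal.ofReal (Real.exp (-(2 * d))) := by
  have hpi := Real.pi_pos
  have hpi' := Real.pi_lt_d2
  have hL' : (0 : ℝ) < L := hL
  have hsd : 0 ≤ Real.sqrt d := Real.sqrt_nonneg d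
  have hd0 : 0 ≤ d := by linarith
  set K : ℝ := Real.pi * Real.sqrt d * L with hK
  have hK0 : 0 ≤ K := by positivity
  have hK60 : 18 * K ≤ 60 * L * Real.sqrt d := by
    have : 0 ≤ L * Real.sqrt d := by positivity
    rw [hK]
    nlinarith
  obtain ⟨m, hm⟩ := exists_stdGaussian_abs_sub_ge_le hf (σ := Real.pi / 2 * L)
    (s := 4 * Real.sqrt d) (by positivity) le_rfl (by positivity)
  have hsK : 4 * Real.sqrt d * (Real.pi / 2 * L) = 2 * K := by rw [hK]; ring
  rw [hsK] at hm
  have e0 : Real.exp (-((4 * Real.sqrt d) ^ 2 / 2)) ≤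
      Real.exp (3 * d) * Real.exp (-((4 * Real.sqrt d) ^ 2 / 2)) :=
    le_mul_of_one_le_left (Real.exp_pos _).le (Real.one_le_exp (by positivity))
  have e1 := exp_le_half_pow_of_chaining hd 0
  simp only [Nat.cast_zero, zero_add, mul_one, pow_zero] at e1
  have hm' : ProbabilityTheory.stdGaussian (EuclideanSpace ℝ (Fin n)) {u | 2 * K ≤ |f u - m|} ≤
      ENNReal.ofReal (2 * Real.exp (-((4 * Real.sqrt d) ^ 2 / 2))) := by
    rwa [ENNReal.ofReal_mul (by norm_num), ENNReal.ofReal_ofNat]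
  refine ⟨m, ?_, ?_⟩
  · refine (measure_mono fun u hu => ?_).trans (hm'.trans (ENNReal.ofReal_le_ofReal ?_))
    · simp only [Set.mem_ofPred_eq] at hu ⊢
      linarith
    · nlinarith [Real.exp_pos (-(2 * d))]
  have hnet : ∀ j : ℕ, ∃ s : Finset (EuclideanSpace ℝ (Fin k)), (∀ c ∈ s, ‖c‖ = 1) ∧
      (s.card : ℝ) ≤ (3 * 2 ^ j) ^ k ∧ ∀ x : EuclideanSpace ℝ (Fin k), ‖x‖ = 1 →
        ∃ c ∈ s, ‖x - c‖ ≤ (1 / 2) ^ j := by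
    intro j
    obtain ⟨s, h1, h2, h3⟩ := exists_net_sphere (E := EuclideanSpace ℝ (Fin k))
      (δ := (1 / 2) ^ j) (by positivity) (pow_le_one₀ (by norm_num) (by norm_num))
    refine ⟨s, h1, h2.trans_eq ?_, h3⟩
    rw [finrank_euclideanSpace_fin, one_div, inv_pow, div_inv_eq_mul]
  choose N hN1 hNc hN using hnet
  let P : ℕ → Finset (EuclideanSpace ℝ (Fin k) × EuclideanSpace ℝ (Fin k)) := fun j =>
    ((N j) ×ˢ (N (j + 1))).filter fun q => ‖q.1 - q.2‖ ≤ 2 * (1 / 2) ^ j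
  let B0 : Set (Fin n → Fin k → ℝ) := ⋃ a ∈ N 0, {g | 2 * K ≤ |f (mulVecE g a) - m|}
  let B1 : ℕ → Set (Fin n → Fin k → ℝ) := fun j => ⋃ q ∈ P j,
    {g | 4 * ((j : ℝ) + 1) * (1 / 2) ^ j * K ≤ |f (mulVecE g q.1) - f (mulVecE g q.2)|}
  have hsub : {g | ∃ x : EuclideanSpace ℝ (Fin k), ‖x‖ = 1 ∧
        60 * L * Real.sqrt d < |f (mulVecE g x) - m|} ⊆ B0 ∪ ⋃ j, B1 j := by
    rintro g ⟨x, hx, hgx⟩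
    by_contra hg
    simp only [B0, B1, Set.mem_union, Set.mem_iUnion, Set.mem_ofPred_eq, not_or, not_exists,
      not_le, Prod.forall] at hg
    choose a ha hxa using fun j => hN j x hx
    have hlim : Filter.Tendsto a Filter.atTop (nhds x) := by
      rw [tendsto_iff_norm_sub_tendsto_zero]
      refine squeeze_zero (fun _ => norm_nonneg _) (fun j => ?_)
        (tendsto_pow_atTop_nhds_zero_of_lt_one (r := (1 / 2 : ℝ)) (by norm_num) (by norm_num))
      rw [norm_sub_rev]
      exact hxa j
    have hlimF : Filter.Tendsto (fun j => f (mulVecE g (a j))) Filter.atTop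
        (nhds (f (mulVecE g x))) :=
      ((hf.continuous.comp (continuous_mulVecE g)).tendsto x).comp hlim
    have := abs_sub_le_of_chain (hg.1 (a 0) (ha 0)).le (fun j => (hg.2 j (a j) (a (j + 1)) ?_).le)
      hK0 hlimF
    · linarith
    · simp only [P, Finset.mem_filter, Finset.mem_product]
      refine ⟨⟨ha j, ha (j + 1)⟩, ?_⟩
      have h1 := norm_sub_le (x - a (j + 1)) (x - a j)
      rw [sub_sub_sub_cancel_left] at h1
      have h2 := hxa (j + 1)
      have h3 : (1 / 2 : ℝ) ^ (j + 1) ≤ (1 / 2) ^ j :=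
        pow_le_pow_of_le_one (by norm_num) (by norm_num) (by omega)
      linarith [hxa j]
  have hfm : Measurable f := hf.continuous.measurable
  have hB0 : gaussMatrix n k B0 ≤
      ENNReal.ofReal (Real.exp (3 * d) * (2 * Real.exp (-((4 * Real.sqrt d) ^ 2 / 2)))) := by
    refine measure_biUnion_finset_le_mul _ _ _ ?_ fun a ha => ?_
    · refine (hNc 0).trans ?_
      have h3 : (3 : ℝ) ≤ Real.exp 3 := by linarith [Real.add_one_le_exp (3 : ℝ)]
      calc (3 * 2 ^ 0 : ℝ) ^ k ≤ Real.exp 3 ^ k := by gcongr; norm_num; linarith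
        _ = Real.exp (3 * k) := by rw [← Real.exp_nat_mul]; ring_nf
        _ ≤ _ := Real.exp_le_exp.2 (by linarith)
    · have hms : MeasurableSet {u | 2 * K ≤ |f u - m|} :=
        measurableSet_le measurable_const (hfm.sub_const m).abs
      rw [← map_mulVecE (n := n) (hN1 0 a ha), Measure.map_apply (measurable_mulVecE a) hms] at hm'
      exact hm'
  have hB1 : ∀ j, gaussMatrix n k (B1 j) ≤ ENNReal.ofReal (Real.exp (3 * (j + 1) * d) *
      (2 * Real.exp (-((4 * Real.sqrt d * (j + 1)) ^ 2 / 2)))) := by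
    intro j
    refine measure_biUnion_finset_le_mul _ _ _ ?_ fun q hq => ?_
    · have hc : ((P j).card : ℝ) ≤ (N j).card * (N (j + 1)).card := by
        rw [← Nat.cast_mul, ← Finset.card_product]
        exact_mod_cast Finset.card_filter_le _ _
      refine hc.trans ?_
      have hj : (0 : ℝ) ≤ j := j.cast_nonneg
      calc ((N j).card * (N (j + 1)).card : ℝ) ≤ (3 * 2 ^ j) ^ k * (3 * 2 ^ (j + 1)) ^ k := by
            gcongr
            exacts [hNc j, hNc (j + 1)]
        _ = ((3 * 2 ^ j) * (3 * 2 ^ (j + 1))) ^ k := (mul_pow _ _ _).symm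
        _ ≤ Real.exp (3 * (j + 1)) ^ k := by gcongr; exact three_mul_two_pow_le_exp j
        _ = Real.exp (3 * (j + 1) * k) := by rw [← Real.exp_nat_mul]; ring_nf
        _ ≤ _ := by gcongr
    · simp only [P, Finset.mem_filter, Finset.mem_product] at hq
      have h := gaussMatrix_abs_sub_ge_le (n := n) hf (hN1 j _ hq.1.1) (hN1 (j + 1) _ hq.1.2)
        (σ := Real.pi * (1 / 2) ^ j * L) (s := 4 * Real.sqrt d * (j + 1)) (by positivity) (by
          calc Real.pi / 2 * ‖q.1 - q.2‖ * L ≤ Real.pi / 2 * (2 * (1 / 2) ^ j) * L := by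
                gcongr
                exact hq.2
            _ = _ := by ring) (by positivity)
      rw [ENNReal.ofReal_mul (by norm_num), ENNReal.ofReal_ofNat]
      refine le_trans (le_of_eq ?_) h
      congr 2
      ext g
      rw [show 4 * ((j : ℝ) + 1) * (1 / 2) ^ j * K =
        4 * Real.sqrt d * (j + 1) * (Real.pi * (1 / 2) ^ j * L) by rw [hK]; ring]
  have hB1' : ∀ j, gaussMatrix n k (B1 j) ≤
      ENNReal.ofReal (Real.exp (-(2 * d)) * (1 / 4)) * 2⁻¹ ^ j := by
    intro j
    refine (hB1 j).trans ?_
    rw [show (2⁻¹ : ENNReal) ^ j = ENNReal.ofReal ((1 / 2) ^ j) by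
      rw [ENNReal.ofReal_pow (by norm_num), one_div, ENNReal.ofReal_inv_of_pos (by norm_num)]
      norm_num, ← ENNReal.ofReal_mul (by positivity)]
    refine ENNReal.ofReal_le_ofReal ?_
    linarith [exp_le_half_pow_of_chaining hd j]
  refine (measure_mono hsub).trans ((measure_union_le _ _).trans ?_)
  have hsum : gaussMatrix n k (⋃ j, B1 j) ≤ ENNReal.ofReal (Real.exp (-(2 * d)) * (1 / 2)) := by
    refine (measure_iUnion_le _).trans ((ENNReal.tsum_le_tsum hB1').trans ?_)
    rw [ENNReal.tsum_mul_left, ENNReal.tsum_geometric_two, ← ENNReal.ofReal_ofNat 2,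
      ← ENNReal.ofReal_mul (by positivity)]
    exact ENNReal.ofReal_le_ofReal (by linarith)
  refine (add_le_add hB0 hsum).trans ?_
  rw [← ENNReal.ofReal_add (by positivity) (by positivity)]
  refine ENNReal.ofReal_le_ofReal ?_
  linarith [Real.exp_pos (-(2 * d))]

end Chaining

section Rearrangement

variable {n : ℕ}

theorem exists_perm_decRe (x : Fin n → ℝ) :
    ∃ σ : Equiv.Perm (Fin n), ∀ i, decRe x i = |x (σ i)| :=
  ⟨Fin.revPerm.trans (Tuple.sort fun j => |x j|), fun _ => rfl⟩

theorem decRe_nonneg (x : Fin n → ℝ) (i : Fin n) : 0 ≤ decRe x i := abs_nonneg _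

theorem decRe_antitone (x : Fin n → ℝ) : Antitone (decRe x) := by
  intro i j hij
  exact Tuple.monotone_sort (fun j => |x j|) (Fin.rev_le_rev.2 hij)

theorem decRe_smul (c : ℝ) (x : Fin n → ℝ) (i : Fin n) : decRe (c • x) i = |c| * decRe x i := by
  have h := (Tuple.comp_sort_eq_comp_iff_monotone (f := fun j => |(c • x) j|)
    (σ := Tuple.sort fun j => |x j|)).2 (by
      intro a b hab
      simp only [Function.comp_apply, Pi.smul_apply, smul_eq_mul, abs_mul]
      exact mul_le_mul_of_nonneg_left (Tuple.monotone_sort (fun j => |x j|) hab) (abs_nonneg c))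
  have := congrFun h i.rev
  simp only [Function.comp_apply, Pi.smul_apply, smul_eq_mul, abs_mul] at this
  simp only [decRe, Pi.smul_apply, smul_eq_mul, abs_mul]
  exact this.symm

theorem sum_comp_decRe (x : Fin n → ℝ) (h : ℝ → ℝ) : ∑ i, h (decRe x i) = ∑ i, h |x i| := by
  obtain ⟨σ, hσ⟩ := exists_perm_decRe x
  simp only [hσ]
  exact Equiv.sum_comp σ fun i => h |x i|

theorem sum_mul_comp_perm_le_decRe {a : Fin n → ℝ} (ha : Antitone a) {h : ℝ → ℝ}
    (hh : MonotoneOn h (Set.Ici 0)) (x : Fin n → ℝ) (τ : Equiv.Perm (Fin n)) :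
    ∑ i, a i * h |x (τ i)| ≤ ∑ i, a i * h (decRe x i) := by
  obtain ⟨σ, hσ⟩ := exists_perm_decRe x
  have hanti : Antitone fun i => h (decRe x i) := fun i j hij =>
    hh (decRe_nonneg x j) (decRe_nonneg x i) (decRe_antitone x hij)
  have h1 := (ha.monovary hanti).sum_mul_comp_perm_le_sum_mul (σ := τ.trans σ.symm)
  refine le_trans (le_of_eq ?_) h1
  refine Finset.sum_congr rfl fun i _ => ?_
  simp [hσ]

theorem succ_mul_decRe_le_sum {h : ℝ → ℝ} (hh : MonotoneOn h (Set.Ici 0))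
    (h0 : ∀ t, 0 ≤ t → 0 ≤ h t) (x : Fin n → ℝ) (i : Fin n) :
    ((i : ℝ) + 1) * h (decRe x i) ≤ ∑ j, h |x j| := by
  rw [← sum_comp_decRe]
  calc ((i : ℝ) + 1) * h (decRe x i) = ∑ j ∈ Finset.Iic i, h (decRe x i) := by simp
    _ ≤ ∑ j ∈ Finset.Iic i, h (decRe x j) := Finset.sum_le_sum fun j hj =>
        hh (decRe_nonneg x i) (decRe_nonneg x j) (decRe_antitone x (Finset.mem_Iic.1 hj))
    _ ≤ _ := Finset.sum_le_univ_sum_of_nonneg fun j => h0 _ (decRe_nonneg x j)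

theorem le_decRe_of_lt_card {x : Fin n → ℝ} {s : ℝ} {i : Fin n}
    (h : (i : ℕ) < (Finset.univ.filter fun j => s ≤ |x j|).card) : s ≤ decRe x i := by
  by_contra! hlt
  obtain ⟨σ, hσ⟩ := exists_perm_decRe x
  have h1 : (Finset.univ.filter fun j => s ≤ |x j|).card ≤ (Finset.Iio i).card := by
    refine Finset.card_le_card_of_injOn σ.symm (fun j hj => ?_) σ.symm.injective.injOn
    simp only [Finset.coe_filter, Finset.mem_univ, true_and, Set.mem_ofPred_eq] at hj
    simp only [Finset.coe_Iio, Set.mem_Iio]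
    by_contra! hij
    have := decRe_antitone x hij
    rw [hσ (σ.symm j), Equiv.apply_symm_apply] at this
    linarith
  simp at h1
  omega

theorem rpow_sub_rpow_le {a b p : ℝ} (ha : 0 ≤ a) (hb : 0 ≤ b) (hp : 1 ≤ p) :
    a ^ p - b ^ p ≤ p * a ^ (p - 1) * (a - b) := by
  rcases ha.eq_or_lt with rfl | ha
  · rcases hp.eq_or_lt with rfl | hp
    · simp
    · rw [Real.zero_rpow (by linarith), Real.zero_rpow (by linarith)]
      simpa using Real.rpow_nonneg hb p
  · have h := one_add_mul_self_le_rpow_one_add (s := b / a - 1) (by linarith [div_nonneg hb ha.le]) hp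
    rw [add_sub_cancel, Real.div_rpow hb ha.le, le_div_iff₀ (Real.rpow_pos_of_pos ha p)] at h
    have h2 : a ^ p = a ^ (p - 1) * a := by
      rw [← Real.rpow_add_one ha.ne']; ring_nf
    have h3 : p * (b / a - 1) * a ^ p = p * a ^ (p - 1) * (b - a) := by
      rw [h2]; field_simp
    nlinarith

/-- The sum `∑ ω_i x_[i]^p`, the `p`-th power of the Lorentz norm. -/
noncomputable def lorPow (ω : Fin n → ℝ) (p : ℝ) (x : Fin n → ℝ) : ℝ :=
  ∑ i : Fin n, ω i * decRe x i ^ p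

theorem lorPow_nonneg {ω : Fin n → ℝ} (hω : ∀ i, 0 ≤ ω i) (p : ℝ) (x : Fin n → ℝ) :
    0 ≤ lorPow ω p x :=
  Finset.sum_nonneg fun i _ => mul_nonneg (hω i) (Real.rpow_nonneg (decRe_nonneg x i) p)

theorem lorPow_sub_le {ω : Fin n → ℝ} (hω : Antitone ω) (hω0 : ∀ i, 0 ≤ ω i) {p : ℝ} (hp : 1 ≤ p)
    (x y : EuclideanSpace ℝ (Fin n)) :
    lorPow ω p x - lorPow ω p y ≤
      p * Real.sqrt (lorPow (fun i => ω i ^ 2) (2 * (p - 1)) x) * ‖x - y‖ := by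
  obtain ⟨σ, hσ⟩ := exists_perm_decRe (x : Fin n → ℝ)
  have h1 : ∑ i, ω i * |y (σ i)| ^ p ≤ lorPow ω p y :=
    sum_mul_comp_perm_le_decRe hω (h := fun t => t ^ p)
      (fun a ha b _ hab => Real.rpow_le_rpow ha hab (by linarith)) y σ
  have h2 : lorPow ω p x = ∑ i, ω i * |x (σ i)| ^ p := by simp only [lorPow, hσ]
  have h3 : lorPow (fun i => ω i ^ 2) (2 * (p - 1)) x =
      ∑ i, (ω i * |x (σ i)| ^ (p - 1)) ^ 2 := by
    simp only [lorPow, hσ]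
    refine Finset.sum_congr rfl fun i _ => ?_
    rw [mul_pow, ← Real.rpow_mul_natCast (abs_nonneg _)]
    push_cast
    ring_nf
  have h4 : ‖x - y‖ = Real.sqrt (∑ i, |x (σ i) - y (σ i)| ^ 2) := by
    rw [EuclideanSpace.norm_eq]
    congr 1
    exact (Equiv.sum_comp σ fun i => |x i - y i| ^ 2).symm
  calc lorPow ω p x - lorPow ω p y ≤ ∑ i, ω i * |x (σ i)| ^ p - ∑ i, ω i * |y (σ i)| ^ p := by
        rw [h2]; linarith
    _ = ∑ i, ω i * (|x (σ i)| ^ p - |y (σ i)| ^ p) := by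
        rw [← Finset.sum_sub_distrib]
        exact Finset.sum_congr rfl fun i _ => by ring
    _ ≤ ∑ i, p * ((ω i * |x (σ i)| ^ (p - 1)) * |x (σ i) - y (σ i)|) := by
        refine Finset.sum_le_sum fun i _ => ?_
        have h5 := rpow_sub_rpow_le (abs_nonneg (x (σ i))) (abs_nonneg (y (σ i))) hp
        have h6 : p * |x (σ i)| ^ (p - 1) * (|x (σ i)| - |y (σ i)|) ≤
            p * |x (σ i)| ^ (p - 1) * |x (σ i) - y (σ i)| := by
          gcongr
          exact abs_sub_abs_le_abs_sub _ _
        calc ω i * (|x (σ i)| ^ p - |y (σ i)| ^ p) ≤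
            ω i * (p * |x (σ i)| ^ (p - 1) * |x (σ i) - y (σ i)|) :=
              mul_le_mul_of_nonneg_left (h5.trans h6) (hω0 i)
          _ = _ := by ring
    _ = p * ∑ i, (ω i * |x (σ i)| ^ (p - 1)) * |x (σ i) - y (σ i)| := (Finset.mul_sum _ _ _).symm
    _ ≤ p * (Real.sqrt (∑ i, (ω i * |x (σ i)| ^ (p - 1)) ^ 2) *
          Real.sqrt (∑ i, |x (σ i) - y (σ i)| ^ 2)) := by
        gcongr
        exact Real.sum_mul_le_sqrt_mul_sqrt _ _ _
    _ = _ := by rw [h3, h4]; ring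

theorem exists_lipschitz_extension_lorPow {ω : Fin n → ℝ} (hω : Antitone ω) (hω0 : ∀ i, 0 ≤ ω i)
    {p : ℝ} (hp : 1 ≤ p) (R : NNReal) :
    ∃ f : EuclideanSpace ℝ (Fin n) → ℝ, LipschitzWith (p.toNNReal * R) f ∧
      ∀ x : EuclideanSpace ℝ (Fin n), lorPow (fun i => ω i ^ 2) (2 * (p - 1)) x ≤ R ^ 2 →
        lorPow ω p x = f x := by
  have hlip : LipschitzOnWith (p.toNNReal * R)
      (fun x : EuclideanSpace ℝ (Fin n) => lorPow ω p x)
      {x | lorPow (fun i => ω i ^ 2) (2 * (p - 1)) x ≤ R ^ 2} := by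
    have key : ∀ x y : EuclideanSpace ℝ (Fin n),
        lorPow (fun i => ω i ^ 2) (2 * (p - 1)) x ≤ R ^ 2 →
        lorPow ω p x - lorPow ω p y ≤ p * R * ‖x - y‖ := by
      intro x y hx
      refine (lorPow_sub_le hω hω0 hp x y).trans ?_
      gcongr
      exact Real.sqrt_le_iff.2 ⟨R.2, hx⟩
    refine LipschitzOnWith.of_dist_le_mul fun x hx y hy => ?_
    rw [Real.dist_eq, dist_eq_norm, NNReal.coe_mul, Real.coe_toNNReal _ (by linarith), abs_le]
    have h1 := key x y hx
    have h2 := key y x hy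
    rw [norm_sub_rev] at h2
    constructor <;> linarith
  obtain ⟨f, hf, hfe⟩ := hlip.extend_real
  exact ⟨f, hf, fun x hx => hfe hx⟩

end Rearrangement

section LogSum

variable {n : ℕ}

/-- Division of an index by `m`. -/
def finDiv (m : ℕ) (i : Fin n) : Fin n := ⟨i / m, (Nat.div_le_self _ _).trans_lt i.2⟩

theorem sum_comp_finDiv_le {m : ℕ} (hm : 0 < m) {g : Fin n → ℝ} (hg : ∀ i, 0 ≤ g i) :
    ∑ i, g (finDiv m i) ≤ m * ∑ i, g i := by
  classical
  rw [Finset.sum_comp g (finDiv m), Finset.mul_sum]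
  refine (Finset.sum_le_sum fun j _ => ?_).trans
    (Finset.sum_le_univ_sum_of_nonneg fun j => mul_nonneg m.cast_nonneg (hg j))
  rw [nsmul_eq_mul]
  refine mul_le_mul_of_nonneg_right ?_ (hg j)
  have h : (Finset.univ.filter fun a : Fin n => finDiv m a = j).card ≤
      (Finset.Ico (m * (j : ℕ)) (m * j + m)).card := by
    refine Finset.card_le_card_of_injOn Fin.val (fun a ha => ?_) Fin.val_injective.injOn
    simp only [Finset.coe_filter, Finset.mem_univ, true_and, Set.mem_ofPred_eq] at ha
    have hj : (a : ℕ) / m = j := congrArg Fin.val ha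
    rw [Finset.coe_Ico, Set.mem_Ico, ← hj]
    have h1 := Nat.div_add_mod (a : ℕ) m
    have h2 := Nat.mod_lt (a : ℕ) hm
    omega
  rw [Nat.card_Ico, Nat.add_sub_cancel_left] at h
  exact_mod_cast h

theorem log_three_mul_div_le (hn : 2 ≤ n) (i : Fin n) :
    4 * Real.log (3 * n / ((i : ℝ) + 1)) ≤ 36 * Real.log (n / (((finDiv 2 i : Fin n) : ℝ) + 1)) := by
  have hi : (0 : ℝ) ≤ (i : ℕ) := Nat.cast_nonneg _
  have hn0 : (0 : ℝ) < n := by positivity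
  set j : ℝ := ((finDiv 2 i : Fin n) : ℝ) with hj
  have hjdef : j = (((i : ℕ) / 2 : ℕ) : ℝ) := rfl
  have hj0 : 0 ≤ j := Nat.cast_nonneg _
  have hji : j ≤ (i : ℝ) := by
    rw [hjdef]; exact_mod_cast Nat.div_le_self _ _
  have hj2 : 4 * (j + 1) ≤ 3 * n := by
    rw [hjdef]
    have := i.2
    have h : 4 * ((i : ℕ) / 2 + 1) ≤ 3 * n := by omega
    exact_mod_cast h
  have hx : (4 / 3 : ℝ) ≤ n / (j + 1) := by
    rw [div_le_div_iff₀ (by norm_num) (by positivity)]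
    linarith
  have hlogx : 1 / 4 ≤ Real.log (n / (j + 1)) := by
    have h1 := Real.one_sub_inv_le_log_of_pos (x := n / (j + 1)) (by positivity)
    have h2 : (n / (j + 1))⁻¹ ≤ ((4 / 3 : ℝ))⁻¹ := inv_anti₀ (by norm_num) hx
    rw [show ((4 / 3 : ℝ))⁻¹ = 3 / 4 by norm_num] at h2
    linarith
  have hlog3 : Real.log 3 ≤ 2 := by
    have := Real.log_le_sub_one_of_pos (x := 3) (by norm_num)
    linarith
  have h3 : Real.log (3 * n / ((i : ℝ) + 1)) ≤ Real.log 3 + Real.log (n / (j + 1)) := by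
    rw [← Real.log_mul (by norm_num) (by positivity)]
    refine Real.log_le_log (by positivity) ?_
    rw [mul_div_assoc]
    gcongr
  linarith

theorem sum_mul_log_three_rpow_le (hn : 2 ≤ n) {b : Fin n → ℝ} (hb : Antitone b)
    (hb0 : ∀ i, 0 ≤ b i) {s : ℝ} (hs : 0 ≤ s) :
    ∑ i, b i * (4 * Real.log (3 * n / ((i : ℝ) + 1))) ^ s ≤
      2 * 36 ^ s * ∑ i, b i * Real.log (n / ((i : ℝ) + 1)) ^ s := by
  have hn0 : (0 : ℝ) < n := by positivity
  have hlog : ∀ j : Fin n, 0 ≤ Real.log (n / ((j : ℝ) + 1)) := fun j =>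
    Real.log_nonneg ((one_le_div (by positivity)).2 (by exact_mod_cast j.2))
  calc ∑ i, b i * (4 * Real.log (3 * n / ((i : ℝ) + 1))) ^ s ≤
      ∑ i, (fun j : Fin n => 36 ^ s * (b j * Real.log (n / ((j : ℝ) + 1)) ^ s)) (finDiv 2 i) := by
        refine Finset.sum_le_sum fun i _ => ?_
        have h1 : b i ≤ b (finDiv 2 i) := hb (Nat.div_le_self _ _)
        have h2 : (4 * Real.log (3 * n / ((i : ℝ) + 1))) ^ s ≤
            36 ^ s * Real.log (n / (((finDiv 2 i : Fin n) : ℝ) + 1)) ^ s := by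
          rw [← Real.mul_rpow (by norm_num) (hlog _)]
          refine Real.rpow_le_rpow ?_ (log_three_mul_div_le hn i) hs
          have : 0 ≤ Real.log (3 * n / ((i : ℝ) + 1)) := by
            refine Real.log_nonneg ((one_le_div (by positivity)).2 ?_)
            have : ((i : ℝ) + 1) ≤ n := by exact_mod_cast i.2
            linarith
          positivity
        calc _ ≤ b (finDiv 2 i) * (36 ^ s * Real.log (n / (((finDiv 2 i : Fin n) : ℝ) + 1)) ^ s) :=
              mul_le_mul h1 h2 (Real.rpow_nonneg (by
                have : 0 ≤ Real.log (3 * n / ((i : ℝ) + 1)) := by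
                  refine Real.log_nonneg ((one_le_div (by positivity)).2 ?_)
                  have : ((i : ℝ) + 1) ≤ n := by exact_mod_cast i.2
                  linarith
                positivity) s) (hb0 _)
          _ = _ := by ring
    _ ≤ (2 : ℕ) * ∑ j : Fin n, 36 ^ s * (b j * Real.log (n / ((j : ℝ) + 1)) ^ s) :=
        sum_comp_finDiv_le two_pos fun j =>
          mul_nonneg (by positivity) (mul_nonneg (hb0 j) (Real.rpow_nonneg (hlog j) s))
    _ = _ := by rw [← Finset.mul_sum]; push_cast; ring

theorem decRe_sq_le_log {x : Fin n → ℝ} (hx : ∑ j, Real.exp (x j ^ 2 / 4) ≤ 3 * n) (i : Fin n) :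
    decRe x i ^ 2 ≤ 4 * Real.log (3 * n / ((i : ℝ) + 1)) := by
  have h := succ_mul_decRe_le_sum (h := fun t => Real.exp (t ^ 2 / 4)) (fun a ha b _ hab => by
    simp only [Set.mem_Ici] at ha
    refine Real.exp_le_exp.2 ?_
    gcongr) (fun t _ => (Real.exp_pos _).le) x i
  simp only [sq_abs] at h
  have h1 : Real.exp (decRe x i ^ 2 / 4) ≤ 3 * n / ((i : ℝ) + 1) := by
    rw [le_div_iff₀ (by positivity), mul_comm]
    exact h.trans hx
  have h2 := Real.log_le_log (Real.exp_pos _) h1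
  rw [Real.log_exp] at h2
  linarith

theorem rpow_two_mul_eq {t : ℝ} (ht : 0 ≤ t) (s : ℝ) : t ^ (2 * s) = (t ^ 2) ^ s := by
  rw [Real.rpow_mul ht]
  norm_cast

theorem sum_sq_mul_rpow_le_of_exp {ω : Fin n → ℝ} (hn : 2 ≤ n) (hω : Antitone ω)
    (hω0 : ∀ i, 0 ≤ ω i) {p : ℝ} (hp : 1 ≤ p) {x : Fin n → ℝ}
    (hx : ∑ j, Real.exp (x j ^ 2 / 4) ≤ 3 * n) (σ : Equiv.Perm (Fin n)) :
    ∑ i, ω i ^ 2 * |x (σ i)| ^ (2 * (p - 1)) ≤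
      2 * 36 ^ (p - 1) * ∑ i, ω i ^ 2 * Real.log (n / ((i : ℝ) + 1)) ^ (p - 1) := by
  have hω2 : Antitone fun i => ω i ^ 2 := fun i j hij => by
    have := hω hij
    have := hω0 j
    simp only
    gcongr
  have hp1 : 0 ≤ p - 1 := by linarith
  refine (sum_mul_comp_perm_le_decRe hω2 (h := fun t => t ^ (2 * (p - 1)))
    (fun a ha b _ hab => Real.rpow_le_rpow ha hab (by linarith)) x σ).trans ?_
  refine (Finset.sum_le_sum fun i _ => ?_).trans
    (sum_mul_log_three_rpow_le hn hω2 (fun i => sq_nonneg _) hp1)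
  refine mul_le_mul_of_nonneg_left ?_ (sq_nonneg _)
  rw [rpow_two_mul_eq (decRe_nonneg x i)]
  exact Real.rpow_le_rpow (sq_nonneg _) (decRe_sq_le_log hx i) hp1

theorem sum_sq_mul_rpow_le_BGen {ω : Fin n → ℝ} (hω : Antitone ω)
    (hω01 : ∀ i, 0 ≤ ω i ∧ ω i ≤ 1) {p : ℝ} (hp : 1 ≤ p) (w : EuclideanSpace ℝ (Fin n))
    (σ : Equiv.Perm (Fin n)) :
    ∑ i, ω i ^ 2 * |w (σ i)| ^ (2 * (p - 1)) ≤ BGen ω p * (‖w‖ ^ 2) ^ (p - 1) := by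
  have hp1 : 0 ≤ p - 1 := by linarith
  have hnorm : ∑ i, w i ^ 2 = ‖w‖ ^ 2 := by rw [EuclideanSpace.norm_sq_eq]; simp
  unfold BGen
  split_ifs with h1 h2
  · have hω2 : Antitone fun i => ω i ^ 2 := fun i j hij => by
      have := hω hij
      have := (hω01 j).1
      simp only
      gcongr
    refine (sum_mul_comp_perm_le_decRe hω2 (h := fun t => t ^ (2 * (p - 1)))
      (fun a ha b _ hab => Real.rpow_le_rpow ha hab (by linarith)) w σ).trans ?_
    rw [Finset.sum_mul]
    refine Finset.sum_le_sum fun i _ => ?_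
    rw [mul_assoc]
    refine mul_le_mul_of_nonneg_left ?_ (sq_nonneg _)
    simp only
    rw [rpow_two_mul_eq (decRe_nonneg _ i), Real.rpow_neg (by positivity),
      ← Real.inv_rpow (by positivity), ← Real.mul_rpow (by positivity) (by positivity)]
    refine Real.rpow_le_rpow (sq_nonneg _) ?_ hp1
    rw [inv_mul_eq_div, le_div_iff₀ (by positivity), mul_comm, ← hnorm]
    have := succ_mul_decRe_le_sum (h := fun t => t ^ 2) (fun a ha b _ hab => by
      simp only [Set.mem_Ici] at ha
      simp only
      gcongr) (fun t _ => sq_nonneg t) (w : Fin n → ℝ) i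
    simpa only [sq_abs] using this
  · push Not at h1
    have hpq : (1 / (2 - p)).HolderConjugate (1 / (p - 1)) := by
      rw [Real.holderConjugate_iff]
      refine ⟨(one_lt_div (by linarith)).2 (by linarith), ?_⟩
      rw [one_div, one_div, inv_inv, inv_inv]
      ring
    have h := Real.inner_le_Lp_mul_Lq_of_nonneg Finset.univ hpq (f := fun i => ω i ^ 2)
      (g := fun i => |w (σ i)| ^ (2 * (p - 1))) (fun i _ => sq_nonneg _)
      (fun i _ => Real.rpow_nonneg (abs_nonneg _) _)
    refine h.trans (le_of_eq ?_)
    have e1 : ∀ i, (ω i ^ 2) ^ (1 / (2 - p)) = ω i ^ (2 / (2 - p)) := fun i => by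
      rw [← rpow_two_mul_eq (hω01 i).1]
      ring_nf
    have e2 : ∀ i, (|w (σ i)| ^ (2 * (p - 1))) ^ (1 / (p - 1)) = w (σ i) ^ 2 := fun i => by
      rw [← Real.rpow_mul (abs_nonneg _), mul_assoc, mul_one_div_cancel (by linarith), mul_one]
      norm_num
    simp only [e1, e2, one_div_one_div]
    rw [Equiv.sum_comp σ fun i => w i ^ 2, hnorm]
  · push Not at h2
    rw [one_mul]
    have hle : ∀ i, w i ^ 2 ≤ ‖w‖ ^ 2 := fun i => by
      rw [← hnorm]
      exact Finset.single_le_sum (f := fun i => w i ^ 2) (fun j _ => sq_nonneg _) (Finset.mem_univ i)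
    have hsplit : ∀ t : ℝ, 0 ≤ t → t ^ (p - 1) = t * t ^ (p - 2) := fun t ht => by
      rcases ht.eq_or_lt with rfl | ht
      · rw [zero_mul, Real.zero_rpow (by linarith)]
      · rw [show p - 1 = 1 + (p - 2) by ring, Real.rpow_add ht, Real.rpow_one]
    calc ∑ i, ω i ^ 2 * |w (σ i)| ^ (2 * (p - 1)) ≤ ∑ i, |w (σ i)| ^ (2 * (p - 1)) := by
          refine Finset.sum_le_sum fun i _ => mul_le_of_le_one_left
            (Real.rpow_nonneg (abs_nonneg _) _) (pow_le_one₀ (hω01 i).1 (hω01 i).2)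
      _ = ∑ i, (w i ^ 2) ^ (p - 1) := by
          rw [Equiv.sum_comp σ fun i => |w i| ^ (2 * (p - 1))]
          exact Finset.sum_congr rfl fun i _ => by rw [rpow_two_mul_eq (abs_nonneg _), sq_abs]
      _ ≤ ∑ i, w i ^ 2 * (‖w‖ ^ 2) ^ (p - 2) := by
          refine Finset.sum_le_sum fun i _ => ?_
          rw [hsplit _ (sq_nonneg _)]
          have := hle i
          have : 0 ≤ p - 2 := by linarith
          gcongr
      _ = _ := by rw [← Finset.sum_mul, hnorm, ← hsplit _ (sq_nonneg _)]

theorem add_rpow_le_two_mul {a b r : ℝ} (ha : 0 ≤ a) (hb : 0 ≤ b) (hr : 0 ≤ r) :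
    (a + b) ^ r ≤ 2 ^ r * (a ^ r + b ^ r) := by
  have key : ∀ {a b : ℝ}, 0 ≤ a → 0 ≤ b → a ≤ b → (a + b) ^ r ≤ 2 ^ r * (a ^ r + b ^ r) := by
    intro a b ha hb hab
    calc (a + b) ^ r ≤ (2 * b) ^ r := by gcongr; linarith
      _ = 2 ^ r * b ^ r := Real.mul_rpow (by norm_num) hb
      _ ≤ _ := by
        gcongr
        linarith [Real.rpow_nonneg ha r]
  rcases le_total a b with h | h
  · exact key ha hb h
  · rw [add_comm a b, add_comm (a ^ r)]
    exact key hb ha h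

theorem lorPow_sq_add_le {ω : Fin n → ℝ} (hn : 2 ≤ n) (hω : Antitone ω)
    (hω01 : ∀ i, 0 ≤ ω i ∧ ω i ≤ 1) {p : ℝ} (hp : 1 ≤ p) {a w : EuclideanSpace ℝ (Fin n)}
    (ha : ∑ j, Real.exp (a j ^ 2 / 4) ≤ 3 * n) :
    lorPow (fun i => ω i ^ 2) (2 * (p - 1)) (a + w : EuclideanSpace ℝ (Fin n)) ≤
      2 ^ (2 * (p - 1)) *
        (2 * 36 ^ (p - 1) * ∑ i, ω i ^ 2 * Real.log (n / ((i : ℝ) + 1)) ^ (p - 1) +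
          BGen ω p * (‖w‖ ^ 2) ^ (p - 1)) := by
  obtain ⟨σ, hσ⟩ := exists_perm_decRe ((a + w : EuclideanSpace ℝ (Fin n)) : Fin n → ℝ)
  have h1 := sum_sq_mul_rpow_le_of_exp hn hω (fun i => (hω01 i).1) hp ha σ
  have h2 := sum_sq_mul_rpow_le_BGen hω hω01 hp w σ
  refine le_trans ?_ (mul_le_mul_of_nonneg_left (add_le_add h1 h2) (by positivity))
  rw [← Finset.sum_add_distrib, Finset.mul_sum]
  refine Finset.sum_le_sum fun i _ => ?_
  rw [hσ]
  have hr : 0 ≤ 2 * (p - 1) := by linarith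
  have h3 : |(a + w) (σ i)| ^ (2 * (p - 1)) ≤
      2 ^ (2 * (p - 1)) * (|a (σ i)| ^ (2 * (p - 1)) + |w (σ i)| ^ (2 * (p - 1))) := by
    refine le_trans ?_ (add_rpow_le_two_mul (abs_nonneg _) (abs_nonneg _) hr)
    gcongr
    exact abs_add_le _ _
  calc _ ≤ ω i ^ 2 * (2 ^ (2 * (p - 1)) *
        (|a (σ i)| ^ (2 * (p - 1)) + |w (σ i)| ^ (2 * (p - 1)))) :=
        mul_le_mul_of_nonneg_left h3 (sq_nonneg _)
    _ = _ := by ring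

end LogSum

section Events

variable {n : ℕ}

theorem stdGaussian_euclidean_preimage (A : Set (Fin n → ℝ)) :
    ProbabilityTheory.stdGaussian (EuclideanSpace ℝ (Fin n)) {u | (u : Fin n → ℝ) ∈ A} =
      _root_.stdGaussian n A := by
  rw [← map_pi_eq_stdGaussian]
  exact (MeasurableEquiv.toLp 2 (Fin n → ℝ)).map_apply _

theorem lintegral_exp_sq_div_four_gaussianReal_le :
    ∫⁻ x, ENNReal.ofReal (Real.exp (x ^ 2 / 4)) ∂(gaussianReal 0 1) ≤ ENNReal.ofReal (3 / 2) := by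
  rw [gaussianReal_of_var_ne_zero 0 one_ne_zero,
    lintegral_withDensity_eq_lintegral_mul _ (measurable_gaussianPDF 0 1) (by fun_prop)]
  have h1 : ∀ x : ℝ, (gaussianPDF 0 1 * fun x => ENNReal.ofReal (Real.exp (x ^ 2 / 4))) x =
      ENNReal.ofReal ((√(2 * Real.pi))⁻¹ * Real.exp (-(1 / 4) * x ^ 2)) := by
    intro x
    simp only [Pi.mul_apply, gaussianPDF, gaussianPDFReal]
    rw [← ENNReal.ofReal_mul (by positivity), mul_assoc, ← Real.exp_add]
    congr 3
    · simp
    · push_cast; ring_nf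
  simp only [h1]
  rw [← ofReal_integral_eq_lintegral_ofReal]
  · refine ENNReal.ofReal_le_ofReal ?_
    rw [integral_const_mul, integral_gaussian]
    have hpi := Real.pi_pos
    rw [inv_mul_le_iff₀ (by positivity)]
    refine Real.sqrt_le_iff.2 ⟨by positivity, ?_⟩
    rw [mul_pow, Real.sq_sqrt (by positivity)]
    linarith
  · exact (integrable_exp_neg_mul_sq (by norm_num)).const_mul _
  · exact Filter.Eventually.of_forall fun x => by positivity

theorem half_le_stdGaussian_exp_le :
    ENNReal.ofReal (1 / 2) ≤ ProbabilityTheory.stdGaussian (EuclideanSpace ℝ (Fin n))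
      {u | ∑ j, Real.exp (u j ^ 2 / 4) ≤ 3 * n} := by
  rcases Nat.eq_zero_or_pos n with rfl | hn
  · simp
  have hn0 : (0 : ℝ) < n := by positivity
  have hms : MeasurableSet {u : Fin n → ℝ | ∑ j, Real.exp (u j ^ 2 / 4) ≤ 3 * n} :=
    measurableSet_le (by fun_prop) measurable_const
  have h1 := stdGaussian_euclidean_preimage {u : Fin n → ℝ | ∑ j, Real.exp (u j ^ 2 / 4) ≤ 3 * n}
  simp only [Set.mem_ofPred_eq] at h1
  rw [h1]
  have hprob : IsProbabilityMeasure (_root_.stdGaussian n) := by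
    unfold _root_.stdGaussian; infer_instance
  have h2 := prob_add_prob_compl (μ := _root_.stdGaussian n) hms
  have h3 : _root_.stdGaussian n {u : Fin n → ℝ | ∑ j, Real.exp (u j ^ 2 / 4) ≤ 3 * n}ᶜ ≤
      ENNReal.ofReal (1 / 2) := by
    have hmk := meas_ge_le_lintegral_div (μ := _root_.stdGaussian n)
      (f := fun u => ∑ j, ENNReal.ofReal (Real.exp (u j ^ 2 / 4)))
      (ε := ENNReal.ofReal (3 * n)) (Measurable.aemeasurable (by fun_prop))
      (by rw [Ne, ENNReal.ofReal_eq_zero, not_le]; positivity) ENNReal.ofReal_ne_top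
    refine (measure_mono fun u hu => ?_).trans (hmk.trans ?_)
    · simp only [Set.mem_compl_iff, Set.mem_ofPred_eq, not_le] at hu ⊢
      rw [← ENNReal.ofReal_sum_of_nonneg fun j _ => (Real.exp_pos _).le]
      exact ENNReal.ofReal_le_ofReal hu.le
    · rw [lintegral_finsetSum _ fun j _ => by fun_prop]
      have hev : ∀ j : Fin n, ∫⁻ u, ENNReal.ofReal (Real.exp (u j ^ 2 / 4))
          ∂(_root_.stdGaussian n) ≤ ENNReal.ofReal (3 / 2) := by
        intro j
        refine le_trans (le_of_eq ?_) lintegral_exp_sq_div_four_gaussianReal_le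
        exact (measurePreserving_eval (fun _ : Fin n => gaussianReal 0 1) j).lintegral_comp
          (f := fun x => ENNReal.ofReal (Real.exp (x ^ 2 / 4))) (by fun_prop)
      refine (ENNReal.div_le_div_right (Finset.sum_le_card_nsmul _ _ _ fun j _ => hev j) _).trans ?_
      rw [Finset.card_univ, Fintype.card_fin, nsmul_eq_mul, ← ENNReal.ofReal_natCast,
        ← ENNReal.ofReal_mul hn0.le, ← ENNReal.ofReal_div_of_pos (by positivity)]
      refine ENNReal.ofReal_le_ofReal (le_of_eq ?_)
      field_simp
  by_contra! hlt
  have h4 := ENNReal.add_lt_add_of_lt_of_le (h3.trans_lt ENNReal.ofReal_lt_top).ne hlt h3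
  rw [h2, ← ENNReal.ofReal_add (by norm_num) (by norm_num)] at h4
  norm_num at h4

theorem exp_neg_two_mul_lt {d : ℝ} (hd : 1 ≤ d) : Real.exp (-(2 * d)) < 1 / 4 := by
  have h1 : (2.7 : ℝ) ≤ Real.exp 1 := by linarith [Real.exp_one_gt_d9]
  have h2 : (4 : ℝ) < Real.exp 2 := by
    calc (4 : ℝ) < 2.7 ^ 2 := by norm_num
      _ ≤ Real.exp 1 ^ 2 := by gcongr
      _ = Real.exp 2 := by rw [← Real.exp_nat_mul]; norm_num
  calc Real.exp (-(2 * d)) ≤ Real.exp (-2) := Real.exp_le_exp.2 (by linarith)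
    _ = 1 / Real.exp 2 := by rw [Real.exp_neg, one_div]
    _ < 1 / 4 := one_div_lt_one_div_of_lt (by norm_num) h2

theorem exists_mem_of_measure_lt {α : Type*} [MeasurableSpace α] {μ : Measure α} {A B : Set α}
    (h : μ B < μ A) : ∃ a ∈ A, a ∉ B := by
  by_contra! hc
  exact absurd (measure_mono (μ := μ) hc) (not_le.2 h)

theorem gaussMatrix_exists_decomposition_compl_le {k : ℕ} {d : ℝ} (hd : 1 ≤ d) (hkd : k ≤ d) :
    gaussMatrix n k {g | ∃ x : EuclideanSpace ℝ (Fin k), ‖x‖ = 1 ∧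
      ¬ ∃ a w : EuclideanSpace ℝ (Fin n), mulVecE g x = a + w ∧
        ∑ j, Real.exp (a j ^ 2 / 4) ≤ 3 * n ∧ ‖w‖ ≤ 120 * Real.sqrt d} ≤
      ENNReal.ofReal (Real.exp (-(2 * d))) := by
  set T : Set (EuclideanSpace ℝ (Fin n)) := {u | ∑ j, Real.exp (u j ^ 2 / 4) ≤ 3 * n} with hT
  obtain ⟨m, hm1, hm2⟩ := exists_gaussMatrix_abs_sub_gt_le (n := n) hd hkd one_pos
    (Metric.lipschitz_infDist_pt T)
  simp only [NNReal.coe_one, mul_one] at hm1 hm2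
  have hTcl : IsClosed T := isClosed_le (by fun_prop) continuous_const
  have hlt : ENNReal.ofReal (Real.exp (-(2 * d))) < ENNReal.ofReal (1 / 2) :=
    ENNReal.ofReal_lt_ofReal_iff'.2 ⟨by linarith [exp_neg_two_mul_lt hd], by norm_num⟩
  obtain ⟨u, huT, hu⟩ := exists_mem_of_measure_lt
    (hm1.trans_lt (hlt.trans_le half_le_stdGaussian_exp_le))
  have hm : m ≤ 60 * Real.sqrt d := by
    simp only [Set.mem_ofPred_eq, not_lt] at hu
    rw [Metric.infDist_zero_of_mem huT, zero_sub, abs_neg] at hu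
    exact (le_abs_self m).trans hu
  refine (measure_mono ?_).trans hm2
  rintro g ⟨x, hx, hgx⟩
  refine ⟨x, hx, ?_⟩
  by_contra! hle
  refine hgx ?_
  obtain ⟨a, haT, ha⟩ := hTcl.exists_infDist_eq_dist ⟨u, huT⟩ (mulVecE g x)
  refine ⟨a, mulVecE g x - a, by simp, haT, ?_⟩
  rw [← dist_eq_norm, ← ha]
  have := (abs_le.1 hle).2
  linarith

end Events

section LowerBound

variable {n : ℕ}

theorem gaussianReal_abs_lt_le :
    gaussianReal 0 1 {t | |t| < 1 / 8} ≤ ENNReal.ofReal (1 / 8) := by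
  have hset : {t : ℝ | |t| < 1 / 8} = Set.Ioo (-(1 / 8)) (1 / 8) := by
    ext t; simp [abs_lt]
  have hpi := Real.pi_gt_three
  rw [hset, gaussianReal_apply 0 one_ne_zero]
  have h1 : ∀ x ∈ Set.Ioo (-(1 / 8) : ℝ) (1 / 8), gaussianPDF 0 1 x ≤ ENNReal.ofReal (1 / 2) := by
    intro x _
    refine ENNReal.ofReal_le_ofReal ?_
    unfold gaussianPDFReal
    have h2 : (2 : ℝ) ≤ √(2 * Real.pi * (1 : NNReal)) := by
      refine Real.le_sqrt_of_sq_le ?_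
      push_cast
      linarith
    have h3 : Real.exp (-(x - 0) ^ 2 / (2 * (1 : NNReal))) ≤ 1 := by
      refine Real.exp_le_one_iff.2 (div_nonpos_of_nonpos_of_nonneg ?_ (by positivity))
      nlinarith [sq_nonneg (x - 0)]
    calc _ ≤ (2 : ℝ)⁻¹ * 1 := by gcongr
      _ = 1 / 2 := by norm_num
  refine (setLIntegral_mono measurable_const h1).trans ?_
  rw [setLIntegral_const, Real.volume_Ioo, ← ENNReal.ofReal_mul (by norm_num)]
  exact ENNReal.ofReal_le_ofReal (by norm_num)

theorem eight_le_mul_gaussianReal {x : ℝ} (hx : 256 ≤ x) :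
    8 ≤ x * (gaussianReal 0 1).real {t | 1 / 2 * √(Real.log x) ≤ |t|} := by
  set s := 1 / 2 * √(Real.log x) with hs
  have hs0 : 0 ≤ s := by positivity
  have hx0 : 0 < x := by linarith
  have hlog : 0 ≤ Real.log x := Real.log_nonneg (by linarith)
  set y := Real.exp (Real.log x / 4) with hy
  have hy0 : 0 < y := Real.exp_pos _
  have hyx : y ^ 4 = x := by
    rw [hy, ← Real.exp_nat_mul]
    push_cast
    rw [mul_div_cancel₀ _ (by norm_num), Real.exp_log hx0]
  have hy4 : 4 ≤ y := by
    by_contra! h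
    have : y ^ 4 < 4 ^ 4 := by gcongr
    norm_num at this
    linarith
  have hss : s ^ 2 = Real.log x / 4 := by
    rw [hs, mul_pow, Real.sq_sqrt hlog]; ring
  have hpi := Real.pi_lt_d2
  have hc : 1 / 8 ≤ (√(2 * Real.pi))⁻¹ * Real.exp (-1) := by
    have h1 : √(2 * Real.pi) ≤ 2.6 := Real.sqrt_le_iff.2 ⟨by norm_num, by norm_num; linarith⟩
    have h2 : Real.exp 1 ≤ 3 := by linarith [Real.exp_one_lt_d9]
    rw [Real.exp_neg, ← mul_inv, one_div]
    refine inv_anti₀ (by positivity) ?_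
    calc √(2 * Real.pi) * Real.exp 1 ≤ 2.6 * 3 := by gcongr
      _ ≤ 8 := by norm_num
  have hpdf : ∀ t ∈ Set.Icc s (s + 1), 1 / 8 * y⁻¹ ≤ gaussianPDFReal 0 1 t := by
    intro t ht
    unfold gaussianPDFReal
    have h1 : -(t - 0) ^ 2 / (2 * (1 : NNReal)) ≥ -1 + -(Real.log x / 4) := by
      rw [← hss]
      push_cast
      nlinarith [ht.1, ht.2, sq_nonneg (s - 1)]
    calc 1 / 8 * y⁻¹ ≤ (√(2 * Real.pi))⁻¹ * Real.exp (-1) * y⁻¹ := by gcongr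
      _ = (√(2 * Real.pi))⁻¹ * Real.exp (-1 + -(Real.log x / 4)) := by
        rw [Real.exp_add, Real.exp_neg (Real.log x / 4)]; ring
      _ ≤ _ := by
        push_cast at h1 ⊢
        rw [mul_one]
        gcongr
  have hq : ENNReal.ofReal (1 / 8 * y⁻¹) ≤ gaussianReal 0 1 {t | s ≤ |t|} := by
    calc ENNReal.ofReal (1 / 8 * y⁻¹) =
        ∫⁻ t in Set.Icc s (s + 1), ENNReal.ofReal (1 / 8 * y⁻¹) := by
          rw [setLIntegral_const, Real.volume_Icc]; simp
      _ ≤ ∫⁻ t in Set.Icc s (s + 1), gaussianPDF 0 1 t :=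
          setLIntegral_mono (measurable_gaussianPDF 0 1) fun t ht =>
            ENNReal.ofReal_le_ofReal (hpdf t ht)
      _ = gaussianReal 0 1 (Set.Icc s (s + 1)) := (gaussianReal_apply 0 one_ne_zero _).symm
      _ ≤ _ := measure_mono fun t ht => ht.1.trans (le_abs_self t)
  have hq' : 1 / 8 * y⁻¹ ≤ (gaussianReal 0 1).real {t | s ≤ |t|} :=
    (ENNReal.ofReal_le_iff_le_toReal (measure_ne_top _ _)).1 hq
  calc (8 : ℝ) = 1 / 8 * 4 ^ 3 := by norm_num
    _ ≤ 1 / 8 * y ^ 3 := by gcongr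
    _ = x * (1 / 8 * y⁻¹) := by rw [← hyx]; field_simp
    _ ≤ _ := by gcongr

theorem stdGaussian_card_le_le {s : ℝ} {m : ℕ}
    (h : 8 * ((m : ℝ) + 1) ≤ n * (gaussianReal 0 1).real {t | s ≤ |t|}) :
    _root_.stdGaussian n {x | (Finset.univ.filter fun j => s ≤ |x j|).card ≤ m} ≤
      ENNReal.ofReal ((1 / 8) ^ (m + 1)) := by
  classical
  have hprob : IsProbabilityMeasure (_root_.stdGaussian n) := by
    unfold _root_.stdGaussian; infer_instance
  set A : Set ℝ := {t | s ≤ |t|} with hA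
  have hAm : MeasurableSet A := measurableSet_le measurable_const (by fun_prop)
  set q := (gaussianReal 0 1).real A with hq
  have hq0 : 0 ≤ q := measureReal_nonneg
  set e := Real.exp (-1) with he
  have he0 : 0 < e := Real.exp_pos _
  have he1 : e ≤ 1 / 2 := by
    rw [he, Real.exp_neg, ← one_div]
    refine one_div_le_one_div_of_le (by norm_num) ?_
    linarith [Real.add_one_le_exp (1 : ℝ)]
  let f : ℝ → ℝ := fun t => if s ≤ |t| then e else 1
  have hfm : Measurable f := Measurable.ite hAm measurable_const measurable_const
  have hf0 : ∀ t, 0 ≤ f t := fun t => by simp only [f]; split_ifs <;> linarith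
  have hf1 : ∀ t, f t ≤ 1 := fun t => by simp only [f]; split_ifs <;> linarith
  have hfint : ∫ t, f t ∂(gaussianReal 0 1) = 1 - (1 - e) * q := by
    have : f = fun t => 1 - (1 - e) * A.indicator (fun _ => (1 : ℝ)) t := by
      ext t
      by_cases ht : s ≤ |t|
      · simp [f, hA, ht]
      · simp [f, hA, ht]
    rw [this, integral_sub (integrable_const _)
      (((integrable_const (1 : ℝ)).indicator hAm).const_mul _), integral_const_mul,
      integral_indicator_const _ hAm]
    simp [hq]
  have hprod : ∀ x : Fin n → ℝ, ∏ j, f (x j) =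
      e ^ (Finset.univ.filter fun j => s ≤ |x j|).card := by
    intro x
    simp only [f]
    rw [Finset.prod_ite]
    simp
  have hInt : Integrable (fun x : Fin n → ℝ => ∏ j, f (x j)) (_root_.stdGaussian n) := by
    refine Integrable.of_bound (Measurable.aestronglyMeasurable (by fun_prop)) 1
      (Filter.Eventually.of_forall fun x => ?_)
    rw [Real.norm_of_nonneg (Finset.prod_nonneg fun j _ => hf0 _)]
    exact Finset.prod_le_one (fun j _ => hf0 _) fun j _ => hf1 _
  have hmk := mul_meas_ge_le_integral_of_nonneg
    (Filter.Eventually.of_forall fun x => Finset.prod_nonneg fun j _ => hf0 (x j)) hInt (e ^ m)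
  have hpow : ∫ x, ∏ j, f (x j) ∂(_root_.stdGaussian n) = (1 - (1 - e) * q) ^ n := by
    have := integral_fintype_prod_eq_pow (ι := Fin n) (μ := gaussianReal 0 1) f
    rw [Fintype.card_fin, hfint] at this
    exact this
  rw [hpow] at hmk
  have hsub : {x : Fin n → ℝ | (Finset.univ.filter fun j => s ≤ |x j|).card ≤ m} ⊆
      {x | e ^ m ≤ ∏ j, f (x j)} := by
    intro x hx
    simp only [Set.mem_ofPred_eq] at hx ⊢
    rw [hprod]
    exact pow_le_pow_of_le_one he0.le (by linarith) hx
  have hle : (1 - (1 - e) * q) ^ n ≤ Real.exp (-(4 * ((m : ℝ) + 1))) := by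
    have hq1 : q ≤ 1 := measureReal_le_one
    calc (1 - (1 - e) * q) ^ n ≤ Real.exp (-(1 / 2 * q)) ^ n := by
          gcongr
          · nlinarith
          · have := Real.add_one_le_exp (-(1 / 2 * q))
            nlinarith
      _ = Real.exp (-(1 / 2 * (n * q))) := by rw [← Real.exp_nat_mul]; ring_nf
      _ ≤ _ := Real.exp_le_exp.2 (by linarith)
  have hreal : (_root_.stdGaussian n).real {x | e ^ m ≤ ∏ j, f (x j)} ≤ (1 / 8) ^ (m + 1) := by
    have hem : e ^ m = Real.exp (-(m : ℝ)) := by rw [he, ← Real.exp_nat_mul]; ring_nf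
    have h1 : (_root_.stdGaussian n).real {x | e ^ m ≤ ∏ j, f (x j)} ≤
        Real.exp (-3) ^ (m + 1) := by
      have h2 := hmk.trans hle
      rw [hem, mul_comm, ← le_div_iff₀ (Real.exp_pos _), ← Real.exp_sub] at h2
      rw [hem]
      refine h2.trans ?_
      rw [← Real.exp_nat_mul]
      refine Real.exp_le_exp.2 ?_
      push_cast
      have : (0 : ℝ) ≤ m := m.cast_nonneg
      linarith
    refine h1.trans ?_
    gcongr
    rw [show (-3 : ℝ) = ((3 : ℕ) : ℝ) * -1 by norm_num, Real.exp_nat_mul]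
    calc e ^ 3 ≤ (1 / 2) ^ 3 := by gcongr
      _ = 1 / 8 := by norm_num
  exact (measure_mono hsub).trans ((ENNReal.le_ofReal_iff_toReal_le (measure_ne_top _ _)
    (by positivity)).2 hreal)

theorem stdGaussian_decRe_compl_lt (hn : 0 < n) :
    _root_.stdGaussian n {x | (∀ i : Fin n, (i : ℕ) = 0 → 1 / 8 ≤ decRe x i) ∧
      ∀ i : Fin n, 256 * ((i : ℝ) + 1) ≤ n →
        1 / 2 * √(Real.log (n / ((i : ℝ) + 1))) ≤ decRe x i}ᶜ < 1 / 2 := by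
  let B : ℕ → Set (Fin n → ℝ) := fun i => {x | 256 * ((i : ℝ) + 1) ≤ n ∧
    (Finset.univ.filter fun j => 1 / 2 * √(Real.log (n / ((i : ℝ) + 1))) ≤ |x j|).card ≤ i}
  let B0 : Set (Fin n → ℝ) := {x | |x ⟨0, hn⟩| < 1 / 8}
  have hsub : {x : Fin n → ℝ | (∀ i : Fin n, (i : ℕ) = 0 → 1 / 8 ≤ decRe x i) ∧
      ∀ i : Fin n, 256 * ((i : ℝ) + 1) ≤ n →
        1 / 2 * √(Real.log (n / ((i : ℝ) + 1))) ≤ decRe x i}ᶜ ⊆ B0 ∪ ⋃ i, B i := by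
    intro x hx
    by_contra hc
    simp only [B0, B, Set.mem_union, Set.mem_iUnion, Set.mem_ofPred_eq, not_or, not_exists,
      not_lt, not_and, not_le] at hc
    refine hx ⟨fun i hi => ?_, fun i hi => le_decRe_of_lt_card (hc.2 i hi)⟩
    refine le_decRe_of_lt_card (hi ▸ Finset.card_pos.2 ⟨⟨0, hn⟩, by simpa using hc.1⟩)
  have h0 : _root_.stdGaussian n B0 ≤ ENNReal.ofReal (1 / 8) := by
    refine le_trans (le_of_eq ?_) gaussianReal_abs_lt_le
    have hms : MeasurableSet {t : ℝ | |t| < 1 / 8} :=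
      measurableSet_lt (by fun_prop) measurable_const
    exact (measurePreserving_eval (fun _ : Fin n => gaussianReal 0 1) ⟨0, hn⟩).measure_preimage
      hms.nullMeasurableSet
  have h1 : ∀ i, _root_.stdGaussian n (B i) ≤ ENNReal.ofReal (1 / 8) * 2⁻¹ ^ i := by
    intro i
    have h2 : ENNReal.ofReal ((1 / 8) ^ (i + 1)) ≤ ENNReal.ofReal (1 / 8) * 2⁻¹ ^ i := by
      rw [show (2⁻¹ : ENNReal) ^ i = ENNReal.ofReal ((1 / 2) ^ i) by
        rw [ENNReal.ofReal_pow (by norm_num), one_div, ENNReal.ofReal_inv_of_pos (by norm_num)]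
        norm_num, ← ENNReal.ofReal_mul (by positivity), pow_succ']
      refine ENNReal.ofReal_le_ofReal ?_
      gcongr
      norm_num
    by_cases hi : 256 * ((i : ℝ) + 1) ≤ n
    · refine le_trans (measure_mono fun x hx => hx.2) ((stdGaussian_card_le_le ?_).trans h2)
      have h3 := eight_le_mul_gaussianReal (x := n / ((i : ℝ) + 1))
        (by rw [le_div_iff₀ (by positivity)]; exact hi)
      rw [div_mul_eq_mul_div, le_div_iff₀ (by positivity)] at h3
      exact h3
    · have : B i = ∅ := by
        ext x
        simp [B, hi]
      rw [this, measure_empty]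
      exact bot_le
  refine (measure_mono hsub).trans_lt ((measure_union_le _ _).trans_lt ?_)
  refine (add_le_add h0 ((measure_iUnion_le _).trans (ENNReal.tsum_le_tsum h1))).trans_lt ?_
  rw [ENNReal.tsum_mul_left, ENNReal.tsum_geometric_two, ← ENNReal.ofReal_ofNat 2,
    ← ENNReal.ofReal_mul (by positivity), ← ENNReal.ofReal_add (by norm_num) (by norm_num),
    ← ENNReal.ofReal_one, ← ENNReal.ofReal_div_of_pos (by norm_num)]
  exact ENNReal.ofReal_lt_ofReal_iff'.2 ⟨by norm_num, by norm_num⟩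

theorem sum_mul_log_rpow_le_lorPow {ω : Fin n → ℝ} (hω : Antitone ω) (hω0 : ∀ i, 0 ≤ ω i)
    {p : ℝ} (hp : 0 ≤ p) {x : Fin n → ℝ} (h0 : ∀ i : Fin n, (i : ℕ) = 0 → 1 / 8 ≤ decRe x i)
    (h : ∀ i : Fin n, 256 * ((i : ℝ) + 1) ≤ n →
        1 / 2 * √(Real.log (n / ((i : ℝ) + 1))) ≤ decRe x i) :
    ∑ i, ω i * Real.log (n / ((i : ℝ) + 1)) ^ (p / 2) ≤ 512 * 128 ^ p * lorPow ω p x := by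
  have key : ∀ i : Fin n, Real.log (n / ((i : ℝ) + 1)) ≤ (128 * decRe x (finDiv 512 i)) ^ 2 := by
    intro i
    have hn0 : (0 : ℝ) < n := by have := i.pos; positivity
    set j : Fin n := finDiv 512 i with hj
    have hjdef : (j : ℕ) = (i : ℕ) / 512 := rfl
    have hji : (j : ℝ) ≤ (i : ℝ) := by exact_mod_cast (hjdef ▸ Nat.div_le_self _ _)
    have hd := decRe_nonneg x j
    by_cases hA : 256 * ((j : ℝ) + 1) ≤ n
    · have h1 := h j hA
      have h2 : Real.log (n / ((i : ℝ) + 1)) ≤ Real.log (n / ((j : ℝ) + 1)) := by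
        refine Real.log_le_log (by positivity) ?_
        gcongr
      have h3 : 0 ≤ Real.log (n / ((j : ℝ) + 1)) :=
        Real.log_nonneg ((one_le_div (by positivity)).2 (by exact_mod_cast j.2))
      have h4 : √(Real.log (n / ((j : ℝ) + 1))) ≤ 128 * decRe x j := by linarith
      have h5 : √(Real.log (n / ((j : ℝ) + 1))) ^ 2 ≤ (128 * decRe x j) ^ 2 := by gcongr
      rw [Real.sq_sqrt h3] at h5
      linarith
    · have hA' : n < 256 * ((j : ℕ) + 1) := by
        by_contra! hc
        exact hA (by exact_mod_cast hc)
      have hj0 : (j : ℕ) = 0 := by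
        have := i.2
        omega
      have hn256 : n < 256 := by omega
      have h1 := h0 j hj0
      have h2 : Real.log (n / ((i : ℝ) + 1)) ≤ Real.log (2 ^ 8) := by
        refine Real.log_le_log (by positivity) ?_
        rw [div_le_iff₀ (by positivity)]
        have : (n : ℝ) < 256 := by exact_mod_cast hn256
        have : (0 : ℝ) ≤ (i : ℕ) := Nat.cast_nonneg _
        norm_num
        linarith
      rw [Real.log_pow] at h2
      have h3 := Real.log_two_lt_d9
      push_cast at h2
      nlinarith
  have hlog : ∀ i : Fin n, 0 ≤ Real.log (n / ((i : ℝ) + 1)) := fun i =>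
    Real.log_nonneg ((one_le_div (by positivity)).2 (by exact_mod_cast i.2))
  calc _ ≤ ∑ i, (fun j : Fin n => 128 ^ p * (ω j * decRe x j ^ p)) (finDiv 512 i) := by
        refine Finset.sum_le_sum fun i _ => ?_
        have h1 : ω i ≤ ω (finDiv 512 i) := hω (Nat.div_le_self _ _)
        have hd := decRe_nonneg x (finDiv 512 i)
        have h2 : Real.log (n / ((i : ℝ) + 1)) ^ (p / 2) ≤ 128 ^ p * decRe x (finDiv 512 i) ^ p := by
          rw [← Real.mul_rpow (by norm_num) hd]
          refine (Real.rpow_le_rpow (hlog i) (key i) (by positivity)).trans (le_of_eq ?_)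
          rw [← rpow_two_mul_eq (by positivity)]
          ring_nf
        calc _ ≤ ω (finDiv 512 i) * (128 ^ p * decRe x (finDiv 512 i) ^ p) :=
              mul_le_mul h1 h2 (Real.rpow_nonneg (hlog i) _) (hω0 _)
          _ = _ := by ring
    _ ≤ (512 : ℕ) * ∑ j : Fin n, 128 ^ p * (ω j * decRe x j ^ p) :=
        sum_comp_finDiv_le (by norm_num) fun j =>
          mul_nonneg (by positivity) (mul_nonneg (hω0 j) (Real.rpow_nonneg (decRe_nonneg x j) p))
    _ = _ := by rw [← Finset.mul_sum, lorPow]; push_cast; ring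

theorem sum_mul_log_rpow_le_median {ω : Fin n → ℝ} (hn : 0 < n) (hω : Antitone ω)
    (hω0 : ∀ i, 0 ≤ ω i) {p : ℝ} (hp : 0 < p) {M : ℝ}
    (hM : IsMedian (_root_.stdGaussian n) (lorNormW ω p) M) :
    0 ≤ M ∧ ∑ i, ω i * Real.log (n / ((i : ℝ) + 1)) ^ (p / 2) ≤ 512 * 128 ^ p * M ^ p := by
  obtain ⟨x, hx, hxB⟩ := exists_mem_of_measure_lt ((stdGaussian_decRe_compl_lt hn).trans_le hM.2)
  rw [Set.mem_compl_iff, not_not] at hxB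
  have hF := lorPow_nonneg hω0 p x
  have hx' : lorPow ω p x ^ (1 / p) ≤ M := hx
  have hM0 : 0 ≤ M := (Real.rpow_nonneg hF _).trans hx'
  refine ⟨hM0, (sum_mul_log_rpow_le_lorPow hω hω0 hp.le hxB.1 hxB.2).trans ?_⟩
  gcongr
  have := Real.rpow_le_rpow (Real.rpow_nonneg hF _) hx' hp.le
  rwa [← Real.rpow_mul hF, one_div_mul_cancel hp.ne', Real.rpow_one] at this

end LowerBound

section Assembly

variable {n k : ℕ}

theorem mulVec_smul (g : Fin n → Fin k → ℝ) (t : ℝ) (x : Fin k → ℝ) :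
    mulVec g (t • x) = t • mulVec g x := by
  ext i
  simp only [mulVec, Pi.smul_apply, smul_eq_mul, Finset.mul_sum]
  exact Finset.sum_congr rfl fun j _ => by ring

theorem eucNorm_eq_norm (x : Fin k → ℝ) : eucNorm x = ‖WithLp.toLp 2 x‖ := by
  simp [eucNorm, EuclideanSpace.norm_eq]

theorem lorNormW_eq_rpow (ω : Fin n → ℝ) (p : ℝ) (x : Fin n → ℝ) :
    lorNormW ω p x = lorPow ω p x ^ (1 / p) := rfl

theorem lorNormW_nonneg {ω : Fin n → ℝ} (hω : ∀ i, 0 ≤ ω i) (p : ℝ) (x : Fin n → ℝ) :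
    0 ≤ lorNormW ω p x := Real.rpow_nonneg (lorPow_nonneg hω p x) _

theorem lorNormW_rpow {ω : Fin n → ℝ} (hω : ∀ i, 0 ≤ ω i) {p : ℝ} (hp : p ≠ 0) (x : Fin n → ℝ) :
    lorNormW ω p x ^ p = lorPow ω p x := by
  rw [lorNormW_eq_rpow, ← Real.rpow_mul (lorPow_nonneg hω p x), one_div_mul_cancel hp,
    Real.rpow_one]

theorem lorNormW_smul {ω : Fin n → ℝ} (hω : ∀ i, 0 ≤ ω i) {p : ℝ} (hp : 0 < p) (t : ℝ)
    (x : Fin n → ℝ) : lorNormW ω p (t • x) = |t| * lorNormW ω p x := by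
  have h : lorPow ω p (t • x) = |t| ^ p * lorPow ω p x := by
    simp only [lorPow, decRe_smul, Finset.mul_sum]
    refine Finset.sum_congr rfl fun i _ => ?_
    rw [Real.mul_rpow (abs_nonneg t) (decRe_nonneg x i)]
    ring
  rw [lorNormW_eq_rpow, h, Real.mul_rpow (by positivity) (lorPow_nonneg hω p x),
    ← Real.rpow_mul (abs_nonneg t), mul_one_div_cancel hp.ne', Real.rpow_one, lorNormW_eq_rpow]

/-- Two-sided bounds on the unit sphere extend to all vectors by homogeneity. -/
theorem lorNormW_mulVec_bounds {ω : Fin n → ℝ} (hω : ∀ i, 0 ≤ ω i) {p : ℝ} (hp : 0 < p)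
    {g : Fin n → Fin k → ℝ} {a b : ℝ}
    (h : ∀ x : EuclideanSpace ℝ (Fin k), ‖x‖ = 1 →
      a ≤ lorNormW ω p (mulVecE g x) ∧ lorNormW ω p (mulVecE g x) ≤ b) (x : Fin k → ℝ) :
    a * eucNorm x ≤ lorNormW ω p (mulVec g x) ∧ lorNormW ω p (mulVec g x) ≤ b * eucNorm x := by
  rw [eucNorm_eq_norm]
  set y : EuclideanSpace ℝ (Fin k) := WithLp.toLp 2 x with hy
  rcases eq_or_ne y 0 with h0 | h0
  · have hx : mulVec g x = (0 : ℝ) • mulVec g x := by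
      rw [← mulVec_smul]
      congr 1
      rw [zero_smul]
      simpa [hy] using h0
    rw [hx, lorNormW_smul hω hp, h0]
    simp
  · have hn : 0 < ‖y‖ := norm_pos_iff.2 h0
    have hu := h (‖y‖⁻¹ • y) (by rw [norm_smul, norm_inv, norm_norm, inv_mul_cancel₀ hn.ne'])
    have hx : lorNormW ω p (mulVec g x) = ‖y‖ * lorNormW ω p (mulVecE g (‖y‖⁻¹ • y)) := by
      have h1 := lorNormW_smul hω hp ‖y‖ (mulVec g (‖y‖⁻¹ • x))
      rw [← mulVec_smul, abs_of_pos hn, smul_smul, mul_inv_cancel₀ hn.ne', one_smul] at h1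
      exact h1
    rw [hx]
    constructor <;> nlinarith [hu.1, hu.2]

theorem abs_sub_le_of_abs_rpow_sub_le {a b p ε : ℝ} (ha : 0 ≤ a) (hb : 0 ≤ b) (hp : 1 ≤ p)
    (hε : 0 ≤ ε) (hε1 : ε ≤ 1) (h : |a ^ p - b ^ p| ≤ ε * b ^ p) :
    (1 - ε) * b ≤ a ∧ a ≤ (1 + ε) * b := by
  obtain ⟨h1, h2⟩ := abs_le.1 h
  have hbp : 0 ≤ b ^ p := Real.rpow_nonneg hb p
  have hp0 : 0 < p := by linarith
  constructor
  · refine (Real.rpow_le_rpow_iff (mul_nonneg (by linarith) hb) ha hp0).1 ?_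
    rw [Real.mul_rpow (by linarith) hb]
    have : (1 - ε) ^ p ≤ 1 - ε := by
      simpa using Real.rpow_le_rpow_of_exponent_ge' (x := 1 - ε) (by linarith) (by linarith)
        zero_le_one hp
    nlinarith
  · refine (Real.rpow_le_rpow_iff ha (mul_nonneg (by linarith) hb) hp0).1 ?_
    rw [Real.mul_rpow (by linarith) hb]
    have : 1 + ε ≤ (1 + ε) ^ p := by
      simpa using Real.rpow_le_rpow_of_exponent_le (x := 1 + ε) (by linarith) hp
    nlinarith

/-- The median lies in every interval that carries more than half of the mass. -/
theorem IsMedian.abs_rpow_sub_le {μ : Measure (Fin n → ℝ)} [IsProbabilityMeasure μ]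
    {ω : Fin n → ℝ} (hω : ∀ i, 0 ≤ ω i) {p M m Δ : ℝ} (hp : 0 < p) (hM0 : 0 ≤ M)
    (hM : IsMedian μ (lorNormW ω p) M) (h : μ {u | Δ < |lorPow ω p u - m|} < 1 / 2) :
    |M ^ p - m| ≤ Δ := by
  obtain ⟨u, hu, hu'⟩ := exists_mem_of_measure_lt (h.trans_le hM.1)
  obtain ⟨v, hv, hv'⟩ := exists_mem_of_measure_lt (h.trans_le hM.2)
  simp only [Set.mem_ofPred_eq, not_lt] at hu hu' hv hv'
  have h1 : M ^ p ≤ lorPow ω p u := by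
    rw [← lorNormW_rpow hω hp.ne']
    exact Real.rpow_le_rpow hM0 hu hp.le
  have h2 : lorPow ω p v ≤ M ^ p := by
    rw [← lorNormW_rpow hω hp.ne']
    exact Real.rpow_le_rpow (lorNormW_nonneg hω p v) hv hp.le
  rw [abs_le] at hu' hv' ⊢
  constructor <;> linarith

end Assembly

section Deviation

variable {n k : ℕ}

theorem measurable_lorPow {ω : Fin n → ℝ} (hω : Antitone ω) {p : ℝ} (hp : 0 ≤ p) :
    Measurable (lorPow ω p) := by
  refine measurable_of_Iic fun t => ?_
  have h : lorPow ω p ⁻¹' Set.Iic t =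
      ⋂ τ : Equiv.Perm (Fin n), {x | ∑ i, ω i * |x (τ i)| ^ p ≤ t} := by
    ext x
    simp only [Set.mem_preimage, Set.mem_Iic, Set.mem_iInter, Set.mem_ofPred_eq]
    refine ⟨fun hx τ => ?_, fun hx => ?_⟩
    · exact (sum_mul_comp_perm_le_decRe hω (h := fun s => s ^ p)
        (fun a ha b _ hab => Real.rpow_le_rpow ha hab hp) x τ).trans hx
    · obtain ⟨σ, hσ⟩ := exists_perm_decRe x
      simpa only [lorPow, hσ] using hx σ
  rw [h]
  exact MeasurableSet.iInter fun τ => measurableSet_le (by fun_prop) measurable_const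

theorem gaussMatrix_lorPow_sub_median_gt_le {ω : Fin n → ℝ} (hn : 2 ≤ n) (hk : 0 < k)
    (hω : Antitone ω) (hω01 : ∀ i, 0 ≤ ω i ∧ ω i ≤ 1) {p : ℝ} (hp : 1 ≤ p) {d : ℝ} (hd : 1 ≤ d)
    (hkd : k ≤ d) {M : ℝ} (hM0 : 0 ≤ M) (hM : IsMedian (_root_.stdGaussian n) (lorNormW ω p) M)
    {R : NNReal} (hR : 0 < R)
    (hR2 : 2 ^ (2 * (p - 1)) * (2 * 36 ^ (p - 1) *
        ∑ i : Fin n, ω i ^ 2 * Real.log (n / ((i : ℝ) + 1)) ^ (p - 1) +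
      BGen ω p * (120 ^ 2 * d) ^ (p - 1)) ≤ (R : ℝ) ^ 2) :
    gaussMatrix n k {g | ∃ x : EuclideanSpace ℝ (Fin k), ‖x‖ = 1 ∧
      120 * (p * R) * √d < |lorPow ω p (mulVecE g x) - M ^ p|} ≤
      ENNReal.ofReal (2 * Real.exp (-(2 * d))) := by
  have hω0 : ∀ i, 0 ≤ ω i := fun i => (hω01 i).1
  have hp0 : 0 < p := by linarith
  have hB : 0 ≤ BGen ω p := by
    unfold BGen
    split_ifs
    · exact Finset.sum_nonneg fun i _ => by positivity
    · exact Real.rpow_nonneg (Finset.sum_nonneg fun i _ => Real.rpow_nonneg (hω0 i) _) _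
    · exact zero_le_one
  obtain ⟨f, hf, hfe⟩ := exists_lipschitz_extension_lorPow hω hω0 hp R
  obtain ⟨m, -, hm⟩ := exists_gaussMatrix_abs_sub_gt_le hd hkd
    (mul_pos (Real.toNNReal_pos.2 hp0) hR) hf
  have hdec := gaussMatrix_exists_decomposition_compl_le (n := n) hd hkd
  set E₁ := {g : Fin n → Fin k → ℝ | ∃ x : EuclideanSpace ℝ (Fin k), ‖x‖ = 1 ∧
    60 * ((p.toNNReal * R : NNReal) : ℝ) * √d < |f (mulVecE g x) - m|}
  set E₂ := {g : Fin n → Fin k → ℝ | ∃ x : EuclideanSpace ℝ (Fin k), ‖x‖ = 1 ∧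
    ¬ ∃ a w : EuclideanSpace ℝ (Fin n), mulVecE g x = a + w ∧
        ∑ j, Real.exp (a j ^ 2 / 4) ≤ 3 * n ∧ ‖w‖ ≤ 120 * Real.sqrt d}
  have hE : gaussMatrix n k (E₁ ∪ E₂) ≤ ENNReal.ofReal (2 * Real.exp (-(2 * d))) := by
    refine (measure_union_le _ _).trans ((add_le_add hm hdec).trans_eq ?_)
    rw [← ENNReal.ofReal_add (by positivity) (by positivity),
      ← two_mul (Real.exp _)]
  have hdev : ∀ g ∉ E₁ ∪ E₂, ∀ x : EuclideanSpace ℝ (Fin k), ‖x‖ = 1 →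
      |lorPow ω p (mulVecE g x) - m| ≤ 60 * (p * R) * √d := by
    intro g hg x hx
    simp only [E₁, E₂, Set.mem_union, Set.mem_ofPred_eq, not_or, not_exists, not_and, not_lt] at hg
    obtain ⟨h1, h2⟩ := hg
    have h3 : ∃ a w : EuclideanSpace ℝ (Fin n), mulVecE g x = a + w ∧
        ∑ j, Real.exp (a j ^ 2 / 4) ≤ 3 * n ∧ ‖w‖ ≤ 120 * Real.sqrt d := by
      by_contra! hc
      exact h2 x hx fun a w e ha => not_le.2 (hc a w e ha)
    obtain ⟨a, w, e, ha, hw⟩ := h3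
    have hw2 : ‖w‖ ^ 2 ≤ 120 ^ 2 * d := by
      calc ‖w‖ ^ 2 ≤ (120 * √d) ^ 2 := by gcongr
        _ = _ := by rw [mul_pow, Real.sq_sqrt (by linarith)]
    rw [hfe (mulVecE g x)]
    · have := h1 x hx
      rwa [NNReal.coe_mul, Real.coe_toNNReal _ hp0.le] at this
    · rw [e]
      refine (lorPow_sq_add_le hn hω hω01 hp ha).trans (le_trans ?_ hR2)
      have : (0 : ℝ) ≤ p - 1 := by linarith
      gcongr
  have hmed : |M ^ p - m| ≤ 60 * (p * R) * √d := by
    have : IsProbabilityMeasure (_root_.stdGaussian n) := by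
      unfold _root_.stdGaussian
      infer_instance
    refine IsMedian.abs_rpow_sub_le hω0 hp0 hM0 hM ?_
    set x₀ : EuclideanSpace ℝ (Fin k) := EuclideanSpace.single ⟨0, hk⟩ 1
    have hx₀ : ‖x₀‖ = 1 := by simp [x₀]
    have hms : MeasurableSet {u : EuclideanSpace ℝ (Fin n) |
        (u : Fin n → ℝ) ∈ {u : Fin n → ℝ | 60 * (p * R) * √d < |lorPow ω p u - m|}} := by
      have h1 := (measurable_lorPow hω hp0.le).comp
        (show Measurable fun u : EuclideanSpace ℝ (Fin n) => (u : Fin n → ℝ) by fun_prop)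
      exact measurableSet_lt measurable_const (h1.sub_const m).abs
    rw [← stdGaussian_euclidean_preimage, ← map_mulVecE hx₀,
      Measure.map_apply (measurable_mulVecE x₀) hms]
    refine lt_of_le_of_lt ((measure_mono fun g hg => ?_).trans hE) ?_
    · by_contra hc
      exact absurd (hdev g hc x₀ hx₀) (not_le.2 hg)
    · rw [← ENNReal.ofReal_one, ← ENNReal.ofReal_ofNat 2,
        ← ENNReal.ofReal_div_of_pos (by norm_num)]
      exact ENNReal.ofReal_lt_ofReal_iff'.2 ⟨by linarith [exp_neg_two_mul_lt hd], by norm_num⟩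
  refine (measure_mono fun g hg => ?_).trans hE
  by_contra hc
  obtain ⟨x, hx, hlt⟩ := hg
  have h1 := abs_le.1 (hdev g hc x hx)
  have h2 := abs_le.1 hmed
  refine absurd hlt (not_lt.2 (abs_le.2 ⟨?_, ?_⟩)) <;> linarith

end Deviation

section Dimension

variable {n : ℕ}

theorem BGen_pos {ω : Fin n → ℝ} (hn : 0 < n) (hω0 : ∀ i, 0 ≤ ω i)
    (hω1 : ∀ i : Fin n, (i : ℕ) = 0 → ω i = 1) (p : ℝ) : 0 < BGen ω p := by
  unfold BGen
  have h1 : ω ⟨0, hn⟩ = 1 := hω1 _ rfl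
  split_ifs
  · refine Finset.sum_pos' (fun i _ => by positivity) ⟨⟨0, hn⟩, Finset.mem_univ _, ?_⟩
    rw [h1]
    positivity
  · refine Real.rpow_pos_of_pos (Finset.sum_pos' (fun i _ => Real.rpow_nonneg (hω0 i) _)
      ⟨⟨0, hn⟩, Finset.mem_univ _, ?_⟩) _
    rw [h1]
    positivity
  · exact zero_lt_one

theorem log_div_succ_nonneg (i : Fin n) : 0 ≤ Real.log (n / ((i : ℝ) + 1)) := by
  refine Real.log_nonneg ((one_le_div (by positivity)).2 ?_)
  exact_mod_cast i.2

/-- What a bound `1 ≤ d` on the dimension parameter yields. -/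
theorem bounds_of_one_le_dGen {ω : Fin n → ℝ} (hn : 0 < n) (hω0 : ∀ i, 0 ≤ ω i)
    (hω1 : ∀ i : Fin n, (i : ℕ) = 0 → ω i = 1) {p ε c : ℝ} (hp : 1 ≤ p) (hε : 0 < ε) (hc : 0 < c)
    (hd : 1 ≤ dGen ω p ε c) :
    0 < ∑ i : Fin n, ω i ^ 2 * Real.log (n / ((i : ℝ) + 1)) ^ (p - 1) ∧
    (∑ i : Fin n, ω i ^ 2 * Real.log (n / ((i : ℝ) + 1)) ^ (p - 1)) * dGen ω p ε c ≤
      c ^ p * ((∑ i : Fin n, ω i * Real.log (n / ((i : ℝ) + 1)) ^ (p / 2)) * ε) ^ 2 ∧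
    BGen ω p * dGen ω p ε c ^ p ≤
      c ^ p * ((∑ i : Fin n, ω i * Real.log (n / ((i : ℝ) + 1)) ^ (p / 2)) * ε) ^ 2 := by
  set V := ∑ i : Fin n, ω i ^ 2 * Real.log (n / ((i : ℝ) + 1)) ^ (p - 1) with hV
  set S := ∑ i : Fin n, ω i * Real.log (n / ((i : ℝ) + 1)) ^ (p / 2) with hS
  set d := dGen ω p ε c with hdd
  have hp0 : 0 < p := by linarith
  have hV0 : 0 ≤ V := Finset.sum_nonneg fun i _ =>
    mul_nonneg (sq_nonneg _) (Real.rpow_nonneg (log_div_succ_nonneg i) _)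
  have hS0 : 0 ≤ S := Finset.sum_nonneg fun i _ =>
    mul_nonneg (hω0 i) (Real.rpow_nonneg (log_div_succ_nonneg i) _)
  have hB : 0 < BGen ω p := BGen_pos hn hω0 hω1 p
  have key : d ≤ c ^ p * S ^ 2 * ε ^ 2 / V →
      0 < V ∧ V * d ≤ c ^ p * (S * ε) ^ 2 := by
    intro h
    have hVpos : 0 < V := by
      refine hV0.lt_of_ne fun h0 => ?_
      rw [← h0, div_zero] at h
      linarith
    refine ⟨hVpos, ?_⟩
    rw [le_div_iff₀ hVpos] at h
    linarith
  by_cases h1 : p = 1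
  · have hd1 : d = c ^ p * S ^ 2 * ε ^ 2 / V := by
      rw [hdd, hV, hS, dGen, if_pos h1]
      subst h1
      simp
    have hBV : BGen ω p = V := by
      rw [hV, BGen, if_pos (by rw [h1]; norm_num)]
      subst h1
      simp
    obtain ⟨a, b⟩ := key hd1.le
    refine ⟨a, b, ?_⟩
    have hdp : d ^ p = d := by rw [h1, Real.rpow_one]
    rw [hBV, hdp]
    exact b
  · have hp1 : 0 < p - 1 := by
      have := lt_of_le_of_ne hp (Ne.symm h1)
      linarith
    set X := c ^ p * S ^ 2 * ε ^ 2 / V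
    set Y := c * BGen ω p ^ (-(1 / p)) * S ^ (2 / p) * ε ^ (2 / p) with hY
    have hX0 : 0 ≤ X := by positivity
    have hY0 : 0 ≤ Y := by positivity
    have hd2 : d ≤ min X Y := by
      rw [hdd, dGen, if_neg h1]
      refine mul_le_of_le_one_left (le_min hX0 hY0) (inv_le_one_of_one_le₀ ?_)
      have : 0 < 1 / (p - 1) := by positivity
      linarith
    obtain ⟨a, b⟩ := key (hd2.trans (min_le_left _ _))
    refine ⟨a, b, ?_⟩
    have hYp : Y ^ p = c ^ p * (BGen ω p)⁻¹ * S ^ 2 * ε ^ 2 := by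
      rw [hY, Real.mul_rpow (by positivity) (by positivity),
        Real.mul_rpow (by positivity) (by positivity), Real.mul_rpow hc.le (by positivity),
        ← Real.rpow_mul hB.le, ← Real.rpow_mul hS0, ← Real.rpow_mul hε.le, neg_mul,
        one_div_mul_cancel hp0.ne', div_mul_cancel₀ _ hp0.ne', Real.rpow_neg_one,
        Real.rpow_two, Real.rpow_two]
    calc BGen ω p * d ^ p ≤ BGen ω p * Y ^ p := by
          gcongr
          exact hd2.trans (min_le_right _ _)
      _ = c ^ p * (S * ε) ^ 2 := by
          rw [hYp]
          field_simp

theorem mul_sqrt_le_of_sq_le {p V B d S ε c μ : ℝ} (hp : 1 ≤ p) (hd : 0 < d)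
    (hc : c = ((57600 * 65536) ^ 2)⁻¹) (hS0 : 0 ≤ S) (hε : 0 ≤ ε) (hμ : 0 ≤ μ)
    (hV : V * d ≤ c ^ p * (S * ε) ^ 2) (hB : B * d ^ p ≤ c ^ p * (S * ε) ^ 2)
    (hS : S ≤ 512 * 128 ^ p * μ) :
    120 * (p * √(2 ^ (2 * (p - 1)) * (2 * 36 ^ (p - 1) * V + B * (120 ^ 2 * d) ^ (p - 1)))) * √d ≤
      ε * μ := by
  have hp1 : 0 ≤ p - 1 := by linarith
  have hc0 : 0 < c := by rw [hc]; positivity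
  have hdp : d ^ (p - 1) * d = d ^ p := by
    rw [← Real.rpow_add_one hd.ne']
    ring_nf
  set W := c ^ p * (S * ε) ^ 2 with hW
  have hW0 : 0 ≤ W := by positivity
  have h2p : p ≤ 2 ^ p := by
    have := one_add_mul_self_le_rpow_one_add (s := 1) (by norm_num) hp
    norm_num at this
    linarith
  have h4 : (2 : ℝ) ^ (2 * (p - 1)) ≤ 4 ^ p := by
    rw [Real.rpow_mul (by norm_num)]
    norm_num
  have h36 : (2 : ℝ) * 36 ^ (p - 1) + (120 ^ 2) ^ (p - 1) ≤ 14400 ^ p := by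
    have h1 : (36 : ℝ) ^ (p - 1) ≤ 14400 ^ (p - 1) :=
      Real.rpow_le_rpow (by norm_num) (by norm_num) hp1
    have h2 : (14400 : ℝ) ^ p = 14400 ^ (p - 1) * 14400 := by
      rw [← Real.rpow_add_one (by norm_num)]
      ring_nf
    have h3 : (0 : ℝ) < 14400 ^ (p - 1) := by positivity
    norm_num
    linarith
  have hmain : (2 * 36 ^ (p - 1) * V + B * (120 ^ 2 * d) ^ (p - 1)) * d ≤ 14400 ^ p * W := by
    rw [Real.mul_rpow (by norm_num) hd.le]
    calc (2 * 36 ^ (p - 1) * V + B * ((120 ^ 2) ^ (p - 1) * d ^ (p - 1))) * d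
        = 2 * 36 ^ (p - 1) * (V * d) + (120 ^ 2) ^ (p - 1) * (B * d ^ p) := by
          rw [← hdp]
          ring
      _ ≤ 2 * 36 ^ (p - 1) * W + (120 ^ 2) ^ (p - 1) * W := by gcongr
      _ = (2 * 36 ^ (p - 1) + (120 ^ 2) ^ (p - 1)) * W := by ring
      _ ≤ _ := by gcongr
  rw [mul_assoc, mul_assoc, ← Real.sqrt_mul' _ hd.le, mul_assoc (2 ^ (2 * (p - 1)))]
  have hsq : √(2 ^ (2 * (p - 1)) * ((2 * 36 ^ (p - 1) * V + B * (120 ^ 2 * d) ^ (p - 1)) * d)) ≤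
      √((2 ^ p * 120 ^ p * (57600 * 65536)⁻¹ ^ p * (S * ε)) ^ 2) := by
    refine Real.sqrt_le_sqrt ?_
    calc 2 ^ (2 * (p - 1)) * ((2 * 36 ^ (p - 1) * V + B * (120 ^ 2 * d) ^ (p - 1)) * d)
        ≤ 2 ^ (2 * (p - 1)) * (14400 ^ p * W) := by gcongr
      _ ≤ 4 ^ p * (14400 ^ p * W) := by gcongr
      _ = _ := by
          have e : ∀ t : ℝ, 0 ≤ t → (t ^ 2) ^ p = (t ^ p) ^ 2 := fun t ht => by
            rw [← Real.rpow_natCast_mul ht, mul_comm, Real.rpow_mul_natCast ht]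
          rw [hW, hc, ← inv_pow, e _ (by norm_num), show (4 : ℝ) = 2 ^ 2 by norm_num,
            show (14400 : ℝ) = 120 ^ 2 by norm_num, e _ (by norm_num), e _ (by norm_num)]
          ring
  rw [Real.sqrt_sq (by positivity)] at hsq
  have h120 : (120 : ℝ) ≤ 120 ^ p := by
    simpa using Real.rpow_le_rpow_of_exponent_le (x := 120) (by norm_num) hp
  have h512 : (512 : ℝ) ≤ 512 ^ p := by
    simpa using Real.rpow_le_rpow_of_exponent_le (x := 512) (by norm_num) hp
  calc _ ≤ 120 ^ p * (2 ^ p * (2 ^ p * 120 ^ p * (57600 * 65536)⁻¹ ^ p *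
        ((512 ^ p * 128 ^ p * μ) * ε))) := by
        gcongr
        refine hsq.trans ?_
        gcongr
        exact hS.trans (by gcongr)
    _ = (120 ^ p * 2 ^ p * 2 ^ p * 120 ^ p * (57600 * 65536)⁻¹ ^ p * 512 ^ p * 128 ^ p) *
        (ε * μ) := by ring
    _ = ε * μ := by
        repeat rw [← Real.mul_rpow (by norm_num) (by norm_num)]
        norm_num

end Dimension

section Assembly

instance isProbabilityMeasure_gaussMatrix (n k : ℕ) : IsProbabilityMeasure (gaussMatrix n k) := by
  unfold gaussMatrix
  infer_instance

theorem one_sub_le_toReal_of_compl_le {α : Type*} [MeasurableSpace α] {μ : Measure α}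
    [IsProbabilityMeasure μ] {A : Set α} {δ : ℝ} (hδ : 0 ≤ δ) (h : μ Aᶜ ≤ ENNReal.ofReal δ) :
    1 - δ ≤ (μ A).toReal := by
  have h1 : (1 : ENNReal) ≤ μ A + μ Aᶜ := by
    rw [← measure_univ (μ := μ), ← Set.union_compl_self A]
    exact measure_union_le _ _
  have h2 := ENNReal.toReal_mono (by finiteness) (h1.trans (add_le_add_right h (μ A)))
  rw [ENNReal.toReal_add (by finiteness) (by finiteness), ENNReal.toReal_ofReal hδ,
    ENNReal.toReal_one] at h2
  linarith

end Assembly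

/-- Random embedding into a general finite-dimensional Lorentz space (Theorem `LoMain2`):
there is a universal constant `c > 0` such that for `n ≥ 2`, `ε ∈ (0,1/2)`, `p ∈ [1,∞)`,
a non-increasing weight sequence `ω` in `[0,1]` with `ω₁ = 1`, and `k ≤ d` (with `d` as
defined above), with probability at least `1 - 2 e^{-d}`, for all `x ∈ ℝ^k`,
`(1-ε) |x| M ≤ |Gx|_{ω,p} ≤ (1+ε) |x| M`, where `M` is a median of `|·|_{ω,p}` under the
standard Gaussian on `ℝ^n` (the law of `Ge₁`). -/
theorem dvoretzky_general_lorentz :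
    ∃ c : ℝ, 0 < c ∧
      ∀ (n k : ℕ) (p ε : ℝ) (ω : Fin n → ℝ), 2 ≤ n → 1 ≤ p → 0 < ε → ε < 1 / 2 →
        Antitone ω → (∀ i : Fin n, 0 ≤ ω i ∧ ω i ≤ 1) →
        (∀ i : Fin n, (i : ℕ) = 0 → ω i = 1) →
        (k : ℝ) ≤ dGen ω p ε c →
        ∀ M : ℝ, IsMedian (stdGaussian n) (lorNormW ω p) M →
          1 - 2 * Real.exp (-dGen ω p ε c) ≤
            ((gaussMatrix n k) {g | ∀ x : Fin k → ℝ,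
              (1 - ε) * eucNorm x * M ≤ lorNormW ω p (mulVec g x) ∧
              lorNormW ω p (mulVec g x) ≤ (1 + ε) * eucNorm x * M}).toReal := by
  refine ⟨((57600 * 65536) ^ 2)⁻¹, by positivity, ?_⟩
  intro n k p ε ω hn hp hε hε2 hω hω01 hω1 hkd M hM
  set c : ℝ := ((57600 * 65536) ^ 2)⁻¹ with hc
  have hc0 : 0 < c := by positivity
  set d := dGen ω p ε c with hdd
  have hω0 : ∀ i, 0 ≤ ω i := fun i => (hω01 i).1
  have hp0 : 0 < p := by linarith
  have hn0 : 0 < n := by omega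
  refine one_sub_le_toReal_of_compl_le (by positivity) ?_
  obtain ⟨hM0, hSM⟩ := sum_mul_log_rpow_le_median hn0 hω hω0 hp0 hM
  rcases Nat.eq_zero_or_pos k with rfl | hk
  · rw [Set.compl_empty_iff.2, measure_empty]
    · exact bot_le
    refine Set.eq_univ_of_forall fun g x => ?_
    have h := lorNormW_mulVec_bounds (g := g) hω0 hp0 (a := (1 - ε) * M) (b := (1 + ε) * M)
      (fun y hy => by simp [Subsingleton.elim y 0] at hy) x
    exact ⟨by linarith [h.1], by linarith [h.2]⟩
  have hd : 1 ≤ d := le_trans (by exact_mod_cast hk) hkd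
  obtain ⟨hV0, hV, hB⟩ := bounds_of_one_le_dGen hn0 hω0 hω1 hp hε hc0 hd
  have hB0 := BGen_pos hn0 hω0 hω1 p
  set Q := 2 ^ (2 * (p - 1)) * (2 * 36 ^ (p - 1) *
        ∑ i : Fin n, ω i ^ 2 * Real.log (n / ((i : ℝ) + 1)) ^ (p - 1) +
      BGen ω p * (120 ^ 2 * d) ^ (p - 1)) with hQ
  have hQ0 : 0 < Q := by positivity
  have hdev : 120 * (p * √Q) * √d ≤ ε * M ^ p :=
    mul_sqrt_le_of_sq_le hp (by linarith) hc
      (Finset.sum_nonneg fun i _ =>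
        mul_nonneg (hω0 i) (Real.rpow_nonneg (log_div_succ_nonneg i) _))
      hε.le (Real.rpow_nonneg hM0 p) hV hB hSM
  have hprob := gaussMatrix_lorPow_sub_median_gt_le hn hk hω hω01 hp hd hkd hM0 hM
    (R := ⟨√Q, Real.sqrt_nonneg Q⟩) (Real.sqrt_pos.2 hQ0) (Real.sq_sqrt hQ0.le).ge
  refine (measure_mono fun g hg => ?_).trans (hprob.trans (ENNReal.ofReal_le_ofReal ?_))
  · by_contra hcon
    simp only [Set.mem_ofPred_eq, not_exists, not_and, not_lt] at hcon
    refine hg fun x => ?_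
    have h := lorNormW_mulVec_bounds (g := g) hω0 hp0 (a := (1 - ε) * M) (b := (1 + ε) * M)
      (fun y hy => abs_sub_le_of_abs_rpow_sub_le (lorNormW_nonneg hω0 p _) hM0 hp hε.le
        (by linarith) (by
          rw [lorNormW_rpow hω0 hp0.ne']
          exact (hcon y hy).trans hdev)) x
    exact ⟨by linarith [h.1], by linarith [h.2]⟩
  · have := Real.exp_le_exp.2 (show -(2 * d) ≤ -d by linarith)
    linarith
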